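/- Let β ∈ {ν, ξ, μ}. For all integers r ≥ 2 and n ≥ 2r, n/2^{2r−2} ≤ NGΠ↓ⁿ_β(r;n) ≤ n − 2r + 1. -/

import Mathlib

open scoped Classical

namespace NG

/-- The set of earlier neighbors (back-neighborhood) of vertex `j` in `H`,
with respect to the natural order on `Fin N`. -/
noncomputable def backNbhd {N : ℕ} (H : SimpleGraph (Fin N)) (j : Fin N) :
    Finset (Fin N) :=
  Finset.univ.filter (fun i => (i : ℕ) < (j : ℕ) ∧ H.Adj i j)

/-- The degree of `u` in the subgraph of `H` induced on the first `j` vertices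
(the "stage `j`" graph of the construction). -/
noncomputable def stageDeg {N : ℕ} (H : SimpleGraph (Fin N)) (j : ℕ) (u : Fin N) : ℕ :=
  (Finset.univ.filter (fun w : Fin N => (w : ℕ) < j ∧ (u : ℕ) < j ∧ H.Adj u w)).card

/-- `H` on `Fin N` is a `k`-tree, built in the natural vertex order: the first
`k+1` vertices form a clique, and every later vertex is joined exactly to the
vertices of an existing `k`-clique. -/
def IsKTreeOrd (k : ℕ) (N : ℕ) (H : SimpleGraph (Fin N)) : Prop :=
  1 ≤ k ∧ k + 1 ≤ N ∧
  (∀ i j : Fin N, (i : ℕ) < (j : ℕ) → (j : ℕ) ≤ k → H.Adj i j) ∧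
  (∀ j : Fin N, k < (j : ℕ) →
    (backNbhd H j).card = k ∧ H.IsClique (backNbhd H j : Set (Fin N)))

/-- A linear `k`-tree: a `k`-tree in which each new vertex (after the first added
one) is joined to a `k`-clique containing the vertex added at the previous step. -/
def IsLinearKTreeOrd (k : ℕ) (N : ℕ) (H : SimpleGraph (Fin N)) : Prop :=
  IsKTreeOrd k N H ∧
  ∀ i j : Fin N, (i : ℕ) + 1 = (j : ℕ) → k + 1 < (j : ℕ) → i ∈ backNbhd H j

/-- A `k`-caterpillar: a `k`-tree in which each new vertex (after the first added
one) is joined to a `k`-clique contained in the maximal `(k+1)`-clique created at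
the previous stage. -/
def IsCaterpillarOrd (k : ℕ) (N : ℕ) (H : SimpleGraph (Fin N)) : Prop :=
  IsKTreeOrd k N H ∧
  ∀ i j : Fin N, (i : ℕ) + 1 = (j : ℕ) → k + 1 < (j : ℕ) →
    backNbhd H j ⊆ insert i (backNbhd H i)

/-- A two-sided `k`-tree: a `k`-tree in which each new vertex is joined to a
`k`-clique that either contains a vertex of degree `k` (at that stage) or equals
the `k`-clique to which some previously added vertex was joined. -/
def IsTwoSidedKTreeOrd (k : ℕ) (N : ℕ) (H : SimpleGraph (Fin N)) : Prop :=
  IsKTreeOrd k N H ∧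
  ∀ j : Fin N, k < (j : ℕ) →
    ((∃ u ∈ backNbhd H j, stageDeg H (j : ℕ) u = k) ∨
     (∃ i : Fin N, k < (i : ℕ) ∧ (i : ℕ) < (j : ℕ) ∧ backNbhd H i = backNbhd H j))

/-- The least `k` such that `G` embeds as a subgraph into some graph in the
class `P k`; an edgeless graph gets the value `0`. -/
noncomputable def widthParam (P : ℕ → (N : ℕ) → SimpleGraph (Fin N) → Prop)
    (n : ℕ) (G : SimpleGraph (Fin n)) : ℕ :=
  if G = ⊥ then 0
  else sInf {k | ∃ (N : ℕ) (H : SimpleGraph (Fin N)) (f : Fin n ↪ Fin N),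
    P k N H ∧ ∀ u v : Fin n, G.Adj u v → H.Adj (f u) (f v)}

/-- Tree-width: the least `k` such that `G` is a subgraph of a `k`-tree. -/
noncomputable def treewidth (n : ℕ) (G : SimpleGraph (Fin n)) : ℕ :=
  widthParam IsKTreeOrd n G

/-- Largeur d'arborescence: the least `k` such that `G` is a subgraph of a
two-sided `k`-tree. -/
noncomputable def la (n : ℕ) (G : SimpleGraph (Fin n)) : ℕ :=
  widthParam IsTwoSidedKTreeOrd n G

/-- Path-width: the least `k` such that `G` is a subgraph of a `k`-caterpillar. -/
noncomputable def pw (n : ℕ) (G : SimpleGraph (Fin n)) : ℕ :=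
  widthParam IsCaterpillarOrd n G

/-- Proper path-width: the least `k` such that `G` is a subgraph of a linear
`k`-tree. -/
noncomputable def ppw (n : ℕ) (G : SimpleGraph (Fin n)) : ℕ :=
  widthParam IsLinearKTreeOrd n G

/-- `G` has a complete-graph minor on `m` branch sets: there are `m` pairwise
disjoint nonempty connected vertex sets with an edge between every two of them. -/
def HasCliqueMinor {n : ℕ} (G : SimpleGraph (Fin n)) (m : ℕ) : Prop :=
  ∃ B : Fin m → Finset (Fin n),
    (∀ p, (B p).Nonempty) ∧
    (∀ p, (G.induce ((B p : Finset (Fin n)) : Set (Fin n))).Connected) ∧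
    (∀ p q, p ≠ q → Disjoint (B p) (B q)) ∧
    (∀ p q, p ≠ q → ∃ u ∈ B p, ∃ v ∈ B q, G.Adj u v)

/-- The Hadwiger number: the largest `m` such that `K_m` is a minor of `G`. -/
noncomputable def hadwiger (n : ℕ) (G : SimpleGraph (Fin n)) : ℕ :=
  sSup {m | HasCliqueMinor G m}

/-- `A` is a symmetric matrix whose off-diagonal nonzero pattern is the
adjacency of `G`. -/
def DescribesGraph {n : ℕ} (A : Matrix (Fin n) (Fin n) ℝ)
    (G : SimpleGraph (Fin n)) : Prop :=
  A.IsSymm ∧ ∀ i j : Fin n, i ≠ j → (A i j ≠ 0 ↔ G.Adj i j)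

/-- The Strong Arnold Property: the only symmetric `X` with `AX = O`,
`A∘X = O` and `I∘X = O` is `X = O`. -/
def StrongArnold {n : ℕ} (A : Matrix (Fin n) (Fin n) ℝ) : Prop :=
  ∀ X : Matrix (Fin n) (Fin n) ℝ, X.IsSymm → A * X = 0 →
    (∀ i j, A i j * X i j = 0) → (∀ i, X i i = 0) → X = 0

/-- The nullity of a square real matrix. -/
noncomputable def nullity {n : ℕ} (A : Matrix (Fin n) (Fin n) ℝ) : ℕ :=
  Module.finrank ℝ (LinearMap.ker (Matrix.toLin' A))

/-- The Colin de Verdière type parameter `ξ`: maximum nullity of a matrix in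
`S(G)` with the Strong Arnold Property. -/
noncomputable def xiParam (n : ℕ) (G : SimpleGraph (Fin n)) : ℕ :=
  sSup {m | ∃ A : Matrix (Fin n) (Fin n) ℝ,
    DescribesGraph A G ∧ StrongArnold A ∧ nullity A = m}

/-- The Colin de Verdière type parameter `ν`: maximum nullity of a positive
semidefinite matrix in `S(G)` with the Strong Arnold Property. -/
noncomputable def nuParam (n : ℕ) (G : SimpleGraph (Fin n)) : ℕ :=
  sSup {m | ∃ A : Matrix (Fin n) (Fin n) ℝ,
    DescribesGraph A G ∧ A.PosSemidef ∧ StrongArnold A ∧ nullity A = m}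

/-- The Colin de Verdière number `μ`: maximum nullity of a generalized
Laplacian in `S(G)` with exactly one negative eigenvalue and the Strong Arnold
Property. -/
noncomputable def muParam (n : ℕ) (G : SimpleGraph (Fin n)) : ℕ :=
  sSup {m | ∃ (A : Matrix (Fin n) (Fin n) ℝ) (hA : A.IsHermitian),
    DescribesGraph A G ∧ StrongArnold A ∧
    (Finset.univ.filter (fun i => hA.eigenvalues i < 0)).card = 1 ∧
    (∀ i j : Fin n, i ≠ j → A i j ≤ 0) ∧ nullity A = m}

/-- An `r`-decomposition of `K_n`: spanning subgraphs with pairwise disjoint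
edge sets whose union is all of `K_n`. -/
def IsDecomp {n r : ℕ} (G : Fin r → SimpleGraph (Fin n)) : Prop :=
  (∀ i j : Fin r, i ≠ j → Disjoint (G i) (G j)) ∧ (⨆ i, G i) = ⊤

/-- A non-degenerate `r`-decomposition: every part has at least one edge. -/
def IsNDDecomp {n r : ℕ} (G : Fin r → SimpleGraph (Fin n)) : Prop :=
  IsDecomp G ∧ ∀ i, G i ≠ ⊥

/-- Nordhaus–Gaddum sum upper bound `NGΣ↑_β(r;n)`. -/
noncomputable def NGsumUp {n : ℕ} (β : SimpleGraph (Fin n) → ℕ) (r : ℕ) : ℕ :=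
  sSup {s | ∃ G : Fin r → SimpleGraph (Fin n), IsDecomp G ∧ ∑ i, β (G i) = s}

/-- Nordhaus–Gaddum sum lower bound `NGΣ↓_β(r;n)`. -/
noncomputable def NGsumLow {n : ℕ} (β : SimpleGraph (Fin n) → ℕ) (r : ℕ) : ℕ :=
  sInf {s | ∃ G : Fin r → SimpleGraph (Fin n), IsDecomp G ∧ ∑ i, β (G i) = s}

/-- Non-degenerate Nordhaus–Gaddum sum lower bound `NGΣ↓ⁿ_β(r;n)`. -/
noncomputable def NGsumLowND {n : ℕ} (β : SimpleGraph (Fin n) → ℕ) (r : ℕ) : ℕ :=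
  sInf {s | ∃ G : Fin r → SimpleGraph (Fin n), IsNDDecomp G ∧ ∑ i, β (G i) = s}

/-- Nordhaus–Gaddum product upper bound `NGΠ↑_β(r;n)`. -/
noncomputable def NGprodUp {n : ℕ} (β : SimpleGraph (Fin n) → ℕ) (r : ℕ) : ℕ :=
  sSup {s | ∃ G : Fin r → SimpleGraph (Fin n), IsDecomp G ∧ ∏ i, β (G i) = s}

/-- Non-degenerate Nordhaus–Gaddum product upper bound `NGΠ↑ⁿ_β(r;n)`. -/
noncomputable def NGprodUpND {n : ℕ} (β : SimpleGraph (Fin n) → ℕ) (r : ℕ) : ℕ :=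
  sSup {s | ∃ G : Fin r → SimpleGraph (Fin n), IsNDDecomp G ∧ ∏ i, β (G i) = s}

/-- Nordhaus–Gaddum product lower bound `NGΠ↓_β(r;n)`. -/
noncomputable def NGprodLow {n : ℕ} (β : SimpleGraph (Fin n) → ℕ) (r : ℕ) : ℕ :=
  sInf {s | ∃ G : Fin r → SimpleGraph (Fin n), IsDecomp G ∧ ∏ i, β (G i) = s}

/-- Non-degenerate Nordhaus–Gaddum product lower bound `NGΠ↓ⁿ_β(r;n)`. -/
noncomputable def NGprodLowND {n : ℕ} (β : SimpleGraph (Fin n) → ℕ) (r : ℕ) : ℕ :=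
  sInf {s | ∃ G : Fin r → SimpleGraph (Fin n), IsNDDecomp G ∧ ∏ i, β (G i) = s}

/-- The triangular root `t(r) = ⌈√(2r + 1/4) − 1/2⌉`. -/
noncomputable def trt (r : ℕ) : ℕ := ⌈Real.sqrt (2 * (r : ℝ) + 1 / 4) - 1 / 2⌉₊

/-- `H` is a path together with isolated vertices: its edges are exactly those
of a path through some list of distinct vertices. -/
def IsPathGraph {n : ℕ} (H : SimpleGraph (Fin n)) : Prop :=
  ∃ (m : ℕ) (f : Fin (m + 1) ↪ Fin n), ∀ u v : Fin n,
    H.Adj u v ↔ ∃ a b : Fin (m + 1), (a : ℕ) + 1 = (b : ℕ) ∧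
      ((u = f a ∧ v = f b) ∨ (u = f b ∧ v = f a))

end NG

namespace NGP

/-- cut-connected vertex set -/
def Conn {V : Type} (G : SimpleGraph V) (B : Finset V) : Prop :=
  B.Nonempty ∧ ∀ A ⊆ B, A.Nonempty → A ≠ B → ∃ a ∈ A, ∃ b ∈ B, b ∉ A ∧ G.Adj a b

/-- complete minor model inside `S` -/
def Model {V : Type} (G : SimpleGraph V) (S : Finset V) (m : ℕ) : Prop :=
  ∃ B : Fin m → Finset V, (∀ p, Conn G (B p)) ∧ (∀ p, B p ⊆ S) ∧
    (∀ p q, p ≠ q → Disjoint (B p) (B q)) ∧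
    (∀ p q, p ≠ q → ∃ u ∈ B p, ∃ v ∈ B q, G.Adj u v)

/-- independent set -/
def Indep {V : Type} (G : SimpleGraph V) (I : Finset V) : Prop :=
  ∀ a ∈ I, ∀ b ∈ I, ¬ G.Adj a b

lemma conn_single {V : Type} (G : SimpleGraph V) (v : V) : Conn G {v} := by
  refine ⟨Finset.singleton_nonempty v, ?_⟩
  intro A hA hne hneq
  exfalso
  rcases Finset.subset_singleton_iff.1 hA with h | h
  · simp [h] at hne
  · exact hneq h

lemma conn_insert {V : Type} {G : SimpleGraph V} {D : Finset V} (hD : Conn G D) {a d : V}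
    (hd : d ∈ D) (had : G.Adj d a) : Conn G (insert a D) := by
  by_cases haD : a ∈ D
  · rwa [Finset.insert_eq_of_mem haD]
  refine ⟨⟨a, by simp⟩, ?_⟩
  intro A hA hne hneq
  by_cases h1 : (A ∩ D).Nonempty
  · by_cases h2 : A ∩ D = D
    · have hDA : D ⊆ A := by rw [← h2]; exact Finset.inter_subset_left
      have haA : a ∉ A := by
        intro h
        apply hneq
        apply Finset.Subset.antisymm hA
        intro x hx
        rcases Finset.mem_insert.1 hx with rfl | hx
        · exact h
        · exact hDA hx
      exact ⟨d, hDA hd, a, by simp, haA, had⟩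
    · obtain ⟨x, hx, y, hy, hyn, hxy⟩ := hD.2 (A ∩ D) Finset.inter_subset_right h1 h2
      refine ⟨x, (Finset.mem_inter.1 hx).1, y, by simp [hy], ?_, hxy⟩
      intro h
      exact hyn (Finset.mem_inter.2 ⟨h, hy⟩)
  · have hno : ∀ x ∈ A, x ∉ D := fun x hx hxD => h1 ⟨x, Finset.mem_inter.2 ⟨hx, hxD⟩⟩
    obtain ⟨x, hx⟩ := hne
    have : x = a := by
      rcases Finset.mem_insert.1 (hA hx) with h | h
      · exact h
      · exact absurd h (hno x hx)
    subst this
    exact ⟨x, hx, d, by simp [hd], fun h => hno d h hd, had.symm⟩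

lemma model_mono {V : Type} {G : SimpleGraph V} {S T : Finset V} (h : S ⊆ T) {m : ℕ}
    (hm : Model G S m) : Model G T m := by
  obtain ⟨B, h1, h2, h3, h4⟩ := hm
  exact ⟨B, h1, fun p => (h2 p).trans h, h3, h4⟩

lemma model_zero {V : Type} (G : SimpleGraph V) (S : Finset V) : Model G S 0 :=
  ⟨fun p => p.elim0, fun p => p.elim0, fun p => p.elim0, fun p => p.elim0, fun p => p.elim0⟩

lemma model_clique {V : Type} (G : SimpleGraph V) (S I : Finset V) (hI : I ⊆ S)
    (hc : ∀ a ∈ I, ∀ b ∈ I, a ≠ b → G.Adj a b) : Model G S I.card := by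
  refine ⟨fun p => {(I.equivFin.symm p : V)}, fun p => conn_single G _, ?_, ?_, ?_⟩
  · intro p
    simp only [Finset.singleton_subset_iff]
    exact hI (I.equivFin.symm p).2
  · intro p q hpq
    simp only [Finset.disjoint_singleton]
    intro h
    exact hpq (I.equivFin.symm.injective (Subtype.ext h))
  · intro p q hpq
    refine ⟨_, Finset.mem_singleton_self _, _, Finset.mem_singleton_self _, ?_⟩
    apply hc _ (I.equivFin.symm p).2 _ (I.equivFin.symm q).2
    intro h
    exact hpq (I.equivFin.symm.injective (Subtype.ext h))

lemma model_cons {V : Type} {G : SimpleGraph V} {S D : Finset V} (hDS : D ⊆ S) (hD : Conn G D)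
    (hdom : ∀ v ∈ S \ D, ∃ d ∈ D, G.Adj d v) {m : ℕ} (hm : Model G (S \ D) m) :
    Model G S (m + 1) := by
  obtain ⟨B, h1, h2, h3, h4⟩ := hm
  have hdis : ∀ p, Disjoint D (B p) := fun p =>
    Finset.disjoint_of_subset_right (h2 p) Finset.disjoint_sdiff
  have hadj : ∀ p, ∃ u ∈ D, ∃ v ∈ B p, G.Adj u v := by
    intro p
    obtain ⟨v, hv⟩ := (h1 p).1
    obtain ⟨d, hd, hdv⟩ := hdom v (h2 p hv)
    exact ⟨d, hd, v, hv, hdv⟩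
  refine ⟨Fin.cons D B, ?_, ?_, ?_, ?_⟩
  · intro p
    refine Fin.cases ?_ (fun p => ?_) p
    · simpa using hD
    · simpa using h1 p
  · intro p
    refine Fin.cases ?_ (fun p => ?_) p
    · simpa using hDS
    · simpa using (h2 p).trans Finset.sdiff_subset
  · intro p q
    refine Fin.cases ?_ (fun p => ?_) p <;> refine Fin.cases ?_ (fun q => ?_) q
    · simp
    · intro _; simpa using hdis q
    · intro _; simpa using (hdis p).symm
    · intro h; simpa using h3 p q (fun h' => h (by rw [h']))
  · intro p q
    refine Fin.cases ?_ (fun p => ?_) p <;> refine Fin.cases ?_ (fun q => ?_) q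
    · simp
    · intro _; simpa using hadj q
    · intro _
      obtain ⟨u, hu, v, hv, huv⟩ := hadj p
      exact ⟨v, by simpa using hv, u, by simpa using hu, huv.symm⟩
    · intro h; simpa using h4 p q (fun h' => h (by rw [h']))

/-- connected dominating set -/
lemma exists_dom {V : Type} (G : SimpleGraph V) (S : Finset V) (hS : Conn G S) :
    ∃ D ⊆ S, Conn G D ∧ (∀ v ∈ S \ D, ∃ d ∈ D, G.Adj d v) ∧
      ∃ I ⊆ D, Indep G I ∧ D.card + 1 ≤ 2 * I.card := by
  let P : Finset V → Prop := fun D => D ⊆ S ∧ Conn G D ∧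
      ∃ I ⊆ D, Indep G I ∧ D.card + 1 ≤ 2 * I.card
  obtain ⟨v, hv⟩ := hS.1
  have hne : (S.powerset.filter P).Nonempty := by
    refine ⟨{v}, ?_⟩
    simp only [Finset.mem_filter, Finset.mem_powerset, Finset.singleton_subset_iff]
    refine ⟨hv, by simpa using hv, conn_single G v, {v}, Finset.Subset.refl _, ?_, by simp⟩
    intro a ha b hb
    simp only [Finset.mem_singleton] at ha hb
    subst ha; subst hb
    exact G.loopless.irrefl _
  obtain ⟨D, hDm, hmax⟩ := Finset.exists_max_image _ Finset.card hne
  obtain ⟨hDS, hDc, I, hID, hI, hcard⟩ := (Finset.mem_filter.1 hDm).2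
  refine ⟨D, hDS, hDc, ?_, I, hID, hI, hcard⟩
  by_contra hcon
  push Not at hcon
  obtain ⟨z, hz, hzn⟩ := hcon
  rw [Finset.mem_sdiff] at hz
  let N : Finset V := S.filter (fun x => x ∈ D ∨ ∃ d ∈ D, G.Adj d x)
  have hNS : N ⊆ S := Finset.filter_subset _ _
  have hDN : D ⊆ N := fun x hx => Finset.mem_filter.2 ⟨hDS hx, Or.inl hx⟩
  have hNne : N ≠ S := by
    intro h
    have : z ∈ N := h ▸ hz.1
    rcases (Finset.mem_filter.1 this).2 with h | ⟨d, hd, hdz⟩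
    · exact hz.2 h
    · exact hzn d hd hdz
  obtain ⟨a, ha, b, hb, hbN, hab⟩ := hS.2 N hNS (hDc.1.mono hDN) hNne
  have hbD : b ∉ D := fun h => hbN (hDN h)
  have hbn : ∀ d ∈ D, ¬ G.Adj d b := fun d hd h =>
    hbN (Finset.mem_filter.2 ⟨hb, Or.inr ⟨d, hd, h⟩⟩)
  have haD : a ∉ D := fun h => hbn a h hab
  obtain ⟨d, hd, hda⟩ : ∃ d ∈ D, G.Adj d a := by
    rcases (Finset.mem_filter.1 ha).2 with h | h
    · exact absurd h haD
    · exact h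
  have hbI : b ∉ insert a D := by
    simp only [Finset.mem_insert, not_or]
    exact ⟨hab.ne', hbD⟩
  have hnew : insert b (insert a D) ∈ S.powerset.filter P := by
    have hsub : insert b (insert a D) ⊆ S := by
      intro x hx
      simp only [Finset.mem_insert] at hx
      rcases hx with rfl | rfl | hx
      · exact hb
      · exact hNS ha
      · exact hDS hx
    refine Finset.mem_filter.2 ⟨Finset.mem_powerset.2 hsub, hsub, ?_, insert b I, ?_, ?_, ?_⟩
    · exact conn_insert (conn_insert hDc hd hda) (Finset.mem_insert_self a D) hab
    · intro x hx
      simp only [Finset.mem_insert] at hx ⊢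
      rcases hx with rfl | hx
      · simp
      · exact Or.inr (Or.inr (hID hx))
    · intro x hx y hy hxy
      simp only [Finset.mem_insert] at hx hy
      rcases hx with rfl | hx <;> rcases hy with rfl | hy
      · exact G.loopless.irrefl _ hxy
      · exact hbn y (hID hy) hxy.symm
      · exact hbn x (hID hx) hxy
      · exact hI x hx y hy hxy
    · rw [Finset.card_insert_of_notMem hbI, Finset.card_insert_of_notMem haD,
        Finset.card_insert_of_notMem (fun h => hbD (hID h))]
      omega
  have := hmax _ hnew
  rw [Finset.card_insert_of_notMem hbI, Finset.card_insert_of_notMem haD] at this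
  omega

/-- Duchet--Meyniel -/
lemma duchet {V : Type} (G : SimpleGraph V) : ∀ (k : ℕ) (S : Finset V), S.card = k →
    ∀ a : ℕ, 1 ≤ a → (∀ I ⊆ S, Indep G I → I.card ≤ a) →
      ∃ m, Model G S m ∧ S.card ≤ m * (2 * a - 1) := by
  intro k
  induction k using Nat.strong_induction_on with
  | _ k ih =>
  intro S hk a ha hI
  by_cases hS0 : S.Nonempty
  swap
  · rw [Finset.not_nonempty_iff_eq_empty] at hS0
    exact ⟨0, model_zero G S, by simp [hS0]⟩
  by_cases hS : Conn G S
  · obtain ⟨D, hDS, hDc, hdom, I, hID, hII, hcard⟩ := exists_dom G S hS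
    have hDpos := Finset.card_pos.2 hDc.1
    have h1 := Finset.card_sdiff_add_card_eq_card hDS
    obtain ⟨m, hm, hle⟩ := ih (S \ D).card (by omega) (S \ D) rfl a ha
      (fun J hJ => hI J (hJ.trans Finset.sdiff_subset))
    refine ⟨m + 1, model_cons hDS hDc hdom hm, ?_⟩
    have h2 := hI I (hID.trans hDS) hII
    have : D.card ≤ 2 * a - 1 := by omega
    rw [add_mul, one_mul]
    omega
  · have : ∃ A ⊆ S, A.Nonempty ∧ A ≠ S ∧ ∀ x ∈ A, ∀ y ∈ S, y ∉ A → ¬ G.Adj x y := by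
      by_contra hcon
      apply hS
      refine ⟨hS0, fun A hA hne hneq => ?_⟩
      by_contra h
      apply hcon
      push Not at h
      exact ⟨A, hA, hne, hneq, h⟩
    obtain ⟨A, hAS, hAne, hAneq, hno⟩ := this
    have hApos := Finset.card_pos.2 hAne
    have h1 := Finset.card_sdiff_add_card_eq_card hAS
    have hBne : (S \ A).Nonempty := by
      rw [Finset.nonempty_iff_ne_empty]
      intro h
      exact hAneq (Finset.Subset.antisymm hAS (Finset.sdiff_eq_empty_iff_subset.1 h))
    have hBpos := Finset.card_pos.2 hBne
    have key : ∀ T : Finset V, T.Nonempty → ∃ I ⊆ T, Indep G I ∧ 1 ≤ I.card ∧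
        ∀ J ⊆ T, Indep G J → J.card ≤ I.card := by
      intro T hT
      obtain ⟨v, hv⟩ := hT
      have hsing : Indep G {v} := by
        intro a ha b hb
        simp only [Finset.mem_singleton] at ha hb
        subst ha; subst hb
        exact G.loopless.irrefl _
      have hmem : ({v} : Finset V) ∈ T.powerset.filter (Indep G) := by
        simp only [Finset.mem_filter, Finset.mem_powerset, Finset.singleton_subset_iff]
        exact ⟨hv, hsing⟩
      obtain ⟨I, hIm, hmax⟩ := Finset.exists_max_image _ Finset.card ⟨_, hmem⟩
      rw [Finset.mem_filter, Finset.mem_powerset] at hIm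
      refine ⟨I, hIm.1, hIm.2, by simpa using hmax _ hmem, fun J hJ hJI => ?_⟩
      exact hmax J (Finset.mem_filter.2 ⟨Finset.mem_powerset.2 hJ, hJI⟩)
    obtain ⟨I1, hI1, hI1i, hI1p, hI1m⟩ := key A hAne
    obtain ⟨I2, hI2, hI2i, hI2p, hI2m⟩ := key (S \ A) hBne
    have hsum : I1.card + I2.card ≤ a := by
      have hd : Disjoint I1 I2 := Finset.disjoint_of_subset_left hI1
        (Finset.disjoint_of_subset_right hI2 Finset.disjoint_sdiff)
      rw [← Finset.card_union_of_disjoint hd]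
      apply hI
      · exact Finset.union_subset (hI1.trans hAS) (hI2.trans Finset.sdiff_subset)
      · intro x hx y hy hxy
        rw [Finset.mem_union] at hx hy
        rcases hx with hx | hx <;> rcases hy with hy | hy
        · exact hI1i x hx y hy hxy
        · have := Finset.mem_sdiff.1 (hI2 hy)
          exact hno x (hI1 hx) y this.1 this.2 hxy
        · have := Finset.mem_sdiff.1 (hI2 hx)
          exact hno y (hI1 hy) x this.1 this.2 hxy.symm
        · exact hI2i x hx y hy hxy
    obtain ⟨m1, hm1, hle1⟩ := ih A.card (by omega) A rfl I1.card hI1p hI1m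
    obtain ⟨m2, hm2, hle2⟩ := ih (S \ A).card (by omega) (S \ A) rfl I2.card hI2p hI2m
    have hfin : ∀ m, m1 ≤ m → m2 ≤ m → S.card ≤ m * (2 * a - 1) := by
      intro m h1' h2'
      calc S.card = (S \ A).card + A.card := h1.symm
        _ ≤ m2 * (2 * I2.card - 1) + m1 * (2 * I1.card - 1) := by omega
        _ ≤ m * (2 * I2.card - 1) + m * (2 * I1.card - 1) := by gcongr
        _ = m * ((2 * I2.card - 1) + (2 * I1.card - 1)) := by ring
        _ ≤ m * (2 * a - 1) := Nat.mul_le_mul_left _ (by omega)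
    rcases le_total m1 m2 with h | h
    · exact ⟨m2, model_mono Finset.sdiff_subset hm2, hfin _ h le_rfl⟩
    · exact ⟨m1, model_mono hAS hm1, hfin _ le_rfl h⟩

/-- splitting a connected set -/
lemma conn_split {V : Type} {G : SimpleGraph V} {D : Finset V} (hD : Conn G D) {u v : V}
    (hu : u ∈ D) (hv : v ∈ D) (huv : u ≠ v) :
    ∃ E ⊆ D, v ∈ E ∧ u ∉ E ∧ Conn G E ∧ Conn G (D \ E) := by
  let P : Finset V → Prop := fun E => v ∈ E ∧ u ∉ E ∧ Conn G E
  have hne : (D.powerset.filter P).Nonempty := by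
    refine ⟨{v}, Finset.mem_filter.2 ⟨by simpa using hv, by simp, by simpa using huv, conn_single G v⟩⟩
  obtain ⟨E, hEm, hmax⟩ := Finset.exists_max_image _ Finset.card hne
  rw [Finset.mem_filter, Finset.mem_powerset] at hEm
  obtain ⟨hED, hvE, huE, hEc⟩ := hEm
  refine ⟨E, hED, hvE, huE, hEc, ⟨u, Finset.mem_sdiff.2 ⟨hu, huE⟩⟩, ?_⟩
  -- no nonempty part avoiding `u` is cut off
  have key : ∀ B ⊆ D \ E, B.Nonempty → u ∉ B → ∃ b ∈ B, ∃ a ∈ D \ E, a ∉ B ∧ G.Adj b a := by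
    intro B hB hBne huB
    have hBD : B ⊆ D := hB.trans Finset.sdiff_subset
    obtain ⟨b, hb, x, hx, hxB, hbx⟩ := hD.2 B hBD hBne (fun h => huB (h ▸ hu))
    by_cases hxE : x ∈ E
    · exfalso
      have hbD := Finset.mem_sdiff.1 (hB hb)
      have hmem : insert b E ∈ D.powerset.filter P := by
        refine Finset.mem_filter.2 ⟨Finset.mem_powerset.2 (Finset.insert_subset hbD.1 hED), ?_, ?_, ?_⟩
        · simp [hvE]
        · simp only [Finset.mem_insert, not_or]
          exact ⟨fun h => huB (h ▸ hb), huE⟩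
        · exact conn_insert hEc hxE hbx.symm
      have := hmax _ hmem
      rw [Finset.card_insert_of_notMem hbD.2] at this
      omega
    · exact ⟨b, hb, x, Finset.mem_sdiff.2 ⟨hx, hxE⟩, hxB, hbx⟩
  intro A hA hAne hAneq
  by_cases huA : u ∈ A
  · have hne2 : ((D \ E) \ A).Nonempty := by
      rw [Finset.nonempty_iff_ne_empty]
      intro h
      exact hAneq (Finset.Subset.antisymm hA (Finset.sdiff_eq_empty_iff_subset.1 h))
    obtain ⟨b, hb, a, ha, hab, hadj⟩ := key ((D \ E) \ A) Finset.sdiff_subset hne2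
      (fun h => (Finset.mem_sdiff.1 h).2 huA)
    rw [Finset.mem_sdiff] at hb
    refine ⟨a, ?_, b, hb.1, hb.2, hadj.symm⟩
    by_contra h
    exact hab (Finset.mem_sdiff.2 ⟨ha, h⟩)
  · obtain ⟨b, hb, a, ha, hab, hadj⟩ := key A hA hAne huA
    exact ⟨b, hb, a, ha, hab, hadj⟩

/-- a vertex with two neighbours in a connected set yields a `K₃` minor -/
lemma model_three {V : Type} {G : SimpleGraph V} {S D : Finset V} (hDS : D ⊆ S) (hD : Conn G D)
    {b u v : V} (hbS : b ∈ S) (hb : b ∉ D) (hu : u ∈ D) (hv : v ∈ D) (huv : u ≠ v)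
    (hbu : G.Adj b u) (hbv : G.Adj b v) : Model G S 3 := by
  obtain ⟨E, hED, hvE, huE, hEc, hFc⟩ := conn_split hD hu hv huv
  have huF : u ∈ D \ E := Finset.mem_sdiff.2 ⟨hu, huE⟩
  obtain ⟨x, hx, y, hy, hyE, hxy⟩ := hD.2 E hED hEc.1 (fun h => huE (h ▸ hu))
  have hyF : y ∈ D \ E := Finset.mem_sdiff.2 ⟨hy, hyE⟩
  have d1 : Disjoint ({b} : Finset V) E := by simpa using fun h => hb (hED h)
  have d2 : Disjoint ({b} : Finset V) (D \ E) := by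
    simpa using fun h => absurd h hb
  have d3 : Disjoint E (D \ E) := Finset.disjoint_sdiff
  refine ⟨![{b}, E, D \ E], ?_, ?_, ?_, ?_⟩
  · intro p
    fin_cases p
    · exact conn_single G b
    · exact hEc
    · exact hFc
  · intro p
    fin_cases p
    · simpa using hbS
    · exact hED.trans hDS
    · exact Finset.sdiff_subset.trans hDS
  · intro p q hpq
    fin_cases p <;> fin_cases q <;> first | exact absurd rfl hpq | skip
    · exact d1
    · exact d2
    · exact d1.symm
    · exact d3
    · exact d2.symm
    · exact d3.symm
  · intro p q hpq
    fin_cases p <;> fin_cases q <;> first | exact absurd rfl hpq | skip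
    · exact ⟨b, by simp, v, hvE, hbv⟩
    · exact ⟨b, by simp, u, huF, hbu⟩
    · exact ⟨v, hvE, b, by simp, hbv.symm⟩
    · exact ⟨x, hx, y, hyF, hxy⟩
    · exact ⟨u, huF, b, by simp, hbu.symm⟩
    · exact ⟨y, hyF, x, hx, hxy.symm⟩

lemma exists_leaf {V : Type} {G : SimpleGraph V} {S : Finset V} (hS : S.Nonempty)
    (h3 : ¬ Model G S 3) :
    ∃ b ∈ S, ∀ u ∈ S, ∀ v ∈ S, G.Adj b u → G.Adj b v → u = v := by
  obtain ⟨v0, hv0⟩ := hS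
  have hne : (S.powerset.filter (Conn G)).Nonempty :=
    ⟨{v0}, Finset.mem_filter.2 ⟨by simpa using hv0, conn_single G v0⟩⟩
  obtain ⟨D, hDm, hmax⟩ := Finset.exists_max_image _ Finset.card hne
  rw [Finset.mem_filter, Finset.mem_powerset] at hDm
  obtain ⟨hDS, hDc⟩ := hDm
  have hclosed : ∀ d ∈ D, ∀ x ∈ S, G.Adj d x → x ∈ D := by
    intro d hd x hx hdx
    by_contra hxD
    have := hmax (insert x D) (Finset.mem_filter.2 ⟨Finset.mem_powerset.2
      (Finset.insert_subset hx hDS), conn_insert hDc hd hdx⟩)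
    rw [Finset.card_insert_of_notMem hxD] at this
    omega
  by_cases h1 : ∃ v ∈ D, D = {v}
  · obtain ⟨v, hv, hDv⟩ := h1
    refine ⟨v, hDS hv, fun u hu w _ hvu _ => ?_⟩
    have := hclosed v hv u hu hvu
    rw [hDv, Finset.mem_singleton] at this
    subst this
    exact absurd hvu (G.loopless.irrefl _)
  · obtain ⟨v, hv⟩ := hDc.1
    have hne2 : ((D.powerset.filter (Conn G)).erase D).Nonempty := by
      refine ⟨{v}, Finset.mem_erase.2 ⟨fun h => h1 ⟨v, hv, h.symm⟩, Finset.mem_filter.2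
        ⟨by simpa using hv, conn_single G v⟩⟩⟩
    obtain ⟨E, hEm, hmaxE⟩ := Finset.exists_max_image _ Finset.card hne2
    rw [Finset.mem_erase, Finset.mem_filter, Finset.mem_powerset] at hEm
    obtain ⟨hEne, hED, hEc⟩ := hEm
    obtain ⟨a, ha, b, hb, hbE, hab⟩ := hDc.2 E hED hEc.1 hEne
    have hins : insert b E = D := by
      by_contra hcon
      have := hmaxE (insert b E) (Finset.mem_erase.2 ⟨hcon, Finset.mem_filter.2
        ⟨Finset.mem_powerset.2 (Finset.insert_subset hb hED), conn_insert hEc ha hab⟩⟩)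
      rw [Finset.card_insert_of_notMem hbE] at this
      omega
    have hnb : ∀ x ∈ S, G.Adj b x → x ∈ E := by
      intro x hx hbx
      have := hclosed b hb x hx hbx
      rw [← hins, Finset.mem_insert] at this
      rcases this with h | h
      · subst h
        exact absurd hbx (G.loopless.irrefl _)
      · exact h
    refine ⟨b, hDS hb, fun u hu w hw hbu hbw => ?_⟩
    by_contra huw
    exact h3 (model_three (hED.trans hDS) hEc (hDS hb) hbE (hnb u hu hbu) (hnb w hw hbw) huw hbu hbw)

lemma forest_indep {V : Type} (G : SimpleGraph V) : ∀ (k : ℕ) (S : Finset V), S.card = k →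
    ¬ Model G S 3 → ∃ I ⊆ S, Indep G I ∧ S.card ≤ 2 * I.card := by
  intro k
  induction k using Nat.strong_induction_on with
  | _ k ih =>
  intro S hk h3
  by_cases hS0 : S.Nonempty
  swap
  · rw [Finset.not_nonempty_iff_eq_empty] at hS0
    exact ⟨∅, by simp, by intro a ha; simp at ha, by simp [hS0]⟩
  obtain ⟨b, hbS, hb⟩ := exists_leaf hS0 h3
  let N : Finset V := S.filter (fun x => x = b ∨ G.Adj b x)
  have hbN : b ∈ N := Finset.mem_filter.2 ⟨hbS, Or.inl rfl⟩
  have hNS : N ⊆ S := Finset.filter_subset _ _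
  have hNcard : N.card ≤ 2 := by
    have : (N.erase b).card ≤ 1 := by
      rw [Finset.card_le_one]
      intro x hx y hy
      rw [Finset.mem_erase, Finset.mem_filter] at hx hy
      exact hb x hx.2.1 y hy.2.1 (hx.2.2.resolve_left hx.1) (hy.2.2.resolve_left hy.1)
    rw [Finset.card_erase_of_mem hbN] at this
    omega
  have hpos := Finset.card_pos.2 ⟨b, hbN⟩
  have h1 := Finset.card_sdiff_add_card_eq_card hNS
  obtain ⟨I, hI, hII, hle⟩ := ih (S \ N).card (by omega) (S \ N) rfl
    (fun h => h3 (model_mono Finset.sdiff_subset h))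
  have hbI : b ∉ I := fun h => (Finset.mem_sdiff.1 (hI h)).2 hbN
  have hnb : ∀ x ∈ I, ¬ G.Adj b x := by
    intro x hx h
    have := Finset.mem_sdiff.1 (hI hx)
    exact this.2 (Finset.mem_filter.2 ⟨this.1, Or.inr h⟩)
  refine ⟨insert b I, Finset.insert_subset hbS (hI.trans Finset.sdiff_subset), ?_, ?_⟩
  · intro x hx y hy hxy
    rw [Finset.mem_insert] at hx hy
    rcases hx with rfl | hx <;> rcases hy with rfl | hy
    · exact G.loopless.irrefl _ hxy
    · exact hnb y hy hxy
    · exact hnb x hx hxy.symm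
    · exact hII x hx y hy hxy
  · rw [Finset.card_insert_of_notMem hbI]
    omega

lemma comb_two {V : Type} (G H : SimpleGraph V) (S : Finset V)
    (hcov : ∀ u ∈ S, ∀ v ∈ S, u ≠ v → G.Adj u v ∨ H.Adj u v) (b c : ℕ) (hb : 1 ≤ b) (hc : 1 ≤ c)
    (hG : ∀ m, Model G S m → m ≤ b + 1) (hH : ∀ m, Model H S m → m ≤ c + 1) :
    S.card ≤ 4 * (b * c) := by
  have hIG : ∀ I ⊆ S, Indep G I → I.card ≤ c + 1 := fun I hI hII =>
    hH _ (model_clique H S I hI fun x hx y hy hxy =>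
      (hcov x (hI hx) y (hI hy) hxy).resolve_left (hII x hx y hy))
  have hIH : ∀ I ⊆ S, Indep H I → I.card ≤ b + 1 := fun I hI hII =>
    hG _ (model_clique G S I hI fun x hx y hy hxy =>
      (hcov x (hI hx) y (hI hy) hxy).resolve_right (hII x hx y hy))
  by_cases hb1 : b = 1
  · subst hb1
    obtain ⟨I, hI, hII, hle⟩ := forest_indep G _ S rfl (fun h => by have := hG _ h; omega)
    have := hIG I hI hII
    omega
  by_cases hc1 : c = 1
  · subst hc1
    obtain ⟨I, hI, hII, hle⟩ := forest_indep H _ S rfl (fun h => by have := hH _ h; omega)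
    have := hIH I hI hII
    omega
  obtain ⟨m, hm, hle⟩ := duchet G _ S rfl (c + 1) (by omega) hIG
  have h1 := hG m hm
  have h2 : m * (2 * (c + 1) - 1) ≤ (b + 1) * (2 * (c + 1) - 1) := Nat.mul_le_mul_right _ h1
  have h3 : 2 * (c + 1) - 1 = 2 * c + 1 := by omega
  rw [h3] at h2
  rw [h3] at hle
  obtain ⟨b', rfl⟩ : ∃ b', b = b' + 2 := ⟨b - 2, by omega⟩
  obtain ⟨c', rfl⟩ : ∃ c', c = c' + 2 := ⟨c - 2, by omega⟩
  nlinarith [Nat.zero_le (b' * c')]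

lemma comb_main {V : Type} : ∀ (r : ℕ) (G : Fin (r + 2) → SimpleGraph V) (S : Finset V)
    (_ : ∀ u ∈ S, ∀ v ∈ S, u ≠ v → ∃ i, (G i).Adj u v) (b : Fin (r + 2) → ℕ)
    (_ : ∀ i, 1 ≤ b i) (_ : ∀ i m, Model (G i) S m → m ≤ b i + 1),
    S.card ≤ 4 ^ (r + 1) * ∏ i, b i := by
  intro r
  induction r with
  | zero =>
    intro G S hcov b hb hM
    have := comb_two (G 0) (G 1) S (fun u hu v hv huv => by
      obtain ⟨i, hi⟩ := hcov u hu v hv huv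
      fin_cases i
      · exact Or.inl hi
      · exact Or.inr hi) (b 0) (b 1) (hb 0) (hb 1) (hM 0) (hM 1)
    simpa [Fin.prod_univ_two] using this
  | succ r ih =>
    intro G S hcov b hb hM
    have hne : (S.powerset.filter (Indep (G 0))).Nonempty :=
      ⟨∅, Finset.mem_filter.2 ⟨by simp, by intro a ha; simp at ha⟩⟩
    obtain ⟨I, hIm, hmax⟩ := Finset.exists_max_image _ Finset.card hne
    rw [Finset.mem_filter, Finset.mem_powerset] at hIm
    obtain ⟨hIS, hII⟩ := hIm
    have h1 := ih (fun i => G i.succ) I (fun u hu v hv huv => by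
      obtain ⟨i, hi⟩ := hcov u (hIS hu) v (hIS hv) huv
      induction i using Fin.cases with
      | zero => exact absurd hi (hII u hu v hv)
      | succ i => exact ⟨i, hi⟩) (fun i => b i.succ) (fun i => hb _)
      (fun i m hm => hM _ m (model_mono hIS hm))
    have hP : 1 ≤ 4 ^ (r + 1) * ∏ i : Fin (r + 2), b i.succ := by
      have : 0 < ∏ i : Fin (r + 2), b i.succ := Finset.prod_pos (fun i _ => hb _)
      have h4 : 0 < 4 ^ (r + 1) := by positivity
      exact Nat.mul_pos h4 this
    obtain ⟨m, hm, hle⟩ := duchet (G 0) _ S rfl (4 ^ (r + 1) * ∏ i : Fin (r + 2), b i.succ) hP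
      (fun J hJ hJI => (hmax J (Finset.mem_filter.2 ⟨Finset.mem_powerset.2 hJ, hJI⟩)).trans h1)
    have h2 := hM 0 m hm
    have h3 := hb 0
    rw [Fin.prod_univ_succ, pow_succ]
    generalize hQ : (∏ i : Fin (r + 2), b i.succ) = Q at *
    calc S.card ≤ m * (2 * (4 ^ (r + 1) * Q) - 1) := hle
      _ ≤ (2 * b 0) * (2 * (4 ^ (r + 1) * Q)) := Nat.mul_le_mul (by omega) (by omega)
      _ = _ := by ring

end NGP

namespace NGP

section core

variable {V ι : Type} [Fintype V] [Fintype ι]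

noncomputable def Cf (B : ι → Finset V) (v : V) (p : ι) : ℝ := if v ∈ B p then 1 else 0

noncomputable def Rf (u : ι → ι → V) (F : V → V → ℝ) (y : Sym2 ι → ℝ) (ε : ℝ) (v w : V) : ℝ :=
  (∑ p, ∑ q, y s(p, q) * (if v = u p q ∧ w = u q p then 1 else 0)) - ε * F v w

noncomputable def Zf (B : ι → Finset V) (U : V → ι → ℝ) (ε : ℝ) (v : V) (q : ι) : ℝ :=
  Cf B v q - ε * U v q

noncomputable def RZ (B : ι → Finset V) (u : ι → ι → V) (F : V → V → ℝ) (y : Sym2 ι → ℝ)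
    (U : V → ι → ℝ) (ε : ℝ) (v : V) (q : ι) : ℝ :=
  ∑ w, Rf u F y ε v w * Zf B U ε w q

noncomputable def F1 (B : ι → Finset V) (u : ι → ι → V) (F : V → V → ℝ) (y : Sym2 ι → ℝ)
    (U : V → ι → ℝ) (ε : ℝ) (t : Sym2 ι) : ℝ :=
  ∑ v, Cf B v (Quot.out t).1 * RZ B u F y U ε v (Quot.out t).2

noncomputable def F2 (B : ι → Finset V) (u : ι → ι → V) (L F : V → V → ℝ) (y : Sym2 ι → ℝ)
    (U : V → ι → ℝ) (ε : ℝ) (v : V) (q : ι) : ℝ :=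
  if (∃ p, v = u p p) then U v q else RZ B u F y U ε v q - ∑ w, L v w * U w q

noncomputable def FF (B : ι → Finset V) (u : ι → ι → V) (L F : V → V → ℝ)
    (z : (Sym2 ι → ℝ) × (V → ι → ℝ) × ℝ) : (Sym2 ι → ℝ) × (V → ι → ℝ) × ℝ :=
  (F1 B u F z.1 z.2.1 z.2.2, F2 B u L F z.1 z.2.1 z.2.2, z.2.2)

lemma FF_contDiff (B : ι → Finset V) (u : ι → ι → V) (L F : V → V → ℝ) :
    ContDiff ℝ 1 (FF B u L F) := by
  have hRZ : ∀ v q, ContDiff ℝ 1 (fun z : (Sym2 ι → ℝ) × (V → ι → ℝ) × ℝ =>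
      RZ B u F z.1 z.2.1 z.2.2 v q) := by
    intro v q
    unfold RZ Rf Zf
    fun_prop
  unfold FF
  refine ContDiff.prodMk ?_ (ContDiff.prodMk ?_ (by fun_prop))
  · rw [contDiff_pi]
    intro t
    unfold F1
    exact ContDiff.sum fun v _ => contDiff_const.mul (hRZ v _)
  · rw [contDiff_pi]
    intro v
    rw [contDiff_pi]
    intro q
    unfold F2
    split_ifs with h
    · fun_prop
    · refine (hRZ v q).sub ?_
      fun_prop

lemma Cf_u {B : ι → Finset V} {u : ι → ι → V} (hu : ∀ p q, u p q ∈ B p)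
    (hdis : ∀ p q, p ≠ q → Disjoint (B p) (B q)) (p q a : ι) :
    Cf B (u p q) a = if p = a then 1 else 0 := by
  unfold Cf
  by_cases h : p = a
  · subst h; simp [hu]
  · rw [if_neg h, if_neg]
    intro h'
    exact Finset.disjoint_left.1 (hdis p a h) (hu p q) h'

lemma F1_zero {B : ι → Finset V} {u : ι → ι → V} (hu : ∀ p q, u p q ∈ B p)
    (hdis : ∀ p q, p ≠ q → Disjoint (B p) (B q)) (F : V → V → ℝ) (y : Sym2 ι → ℝ)
    (U : V → ι → ℝ) : F1 B u F y U 0 = y := by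
  funext t
  have key : ∀ p q : ι, ∑ v, Cf B v p * RZ B u F y U 0 v q = y s(p, q) := by
    intro p q
    have h1 : ∀ v, RZ B u F y U 0 v q = ∑ a, ∑ b, y s(a, b) *
        ((if v = u a b then 1 else 0) * Cf B (u b a) q) := by
      intro v
      unfold RZ Rf Zf
      simp only [zero_mul, sub_zero, Finset.sum_mul]
      rw [Finset.sum_comm]
      refine Finset.sum_congr rfl fun a _ => ?_
      rw [Finset.sum_comm]
      refine Finset.sum_congr rfl fun b _ => ?_
      rw [Finset.sum_eq_single (u b a)]
      · simp
      · intro w _ hw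
        simp [hw]
      · simp
    simp only [h1, Finset.mul_sum]
    rw [Finset.sum_comm]
    have h2 : ∀ a, ∑ v, ∑ b, Cf B v p * (y s(a, b) * ((if v = u a b then 1 else 0) *
        Cf B (u b a) q)) = if a = p then y s(p, q) else 0 := by
      intro a
      rw [Finset.sum_comm]
      have h3 : ∀ b, ∑ v, Cf B v p * (y s(a, b) * ((if v = u a b then 1 else 0) *
        Cf B (u b a) q)) = (if a = p then 1 else 0) * (y s(a, b) * if b = q then 1 else 0) := by
        intro b
        rw [Finset.sum_eq_single (u a b)]
        · rw [Cf_u hu hdis, Cf_u hu hdis]; simp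
        · intro w _ hw
          simp [hw]
        · simp
      simp only [h3]
      by_cases hap : a = p
      · subst hap; simp
      · simp [hap]
    simp only [h2]
    simp
  unfold F1
  rw [key]
  congr 1
  exact Quot.out_eq t

/-- the linear part in `U` -/
noncomputable def LU (u : ι → ι → V) (L : V → V → ℝ) : (V → ι → ℝ) →ₗ[ℝ] (V → ι → ℝ) where
  toFun U := fun v q => if (∃ p, v = u p p) then U v q else - ∑ w, L v w * U w q
  map_add' U U' := by
    funext v q
    simp only [Pi.add_apply]
    split_ifs
    · rfl
    · simp only [mul_add, Finset.sum_add_distrib]; ring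
  map_smul' c U := by
    funext v q
    simp only [Pi.smul_apply, smul_eq_mul, RingHom.id_apply]
    split_ifs
    · rfl
    · rw [mul_neg, Finset.mul_sum]; congr 1
      exact Finset.sum_congr rfl fun _ _ => by ring

lemma LU_inj {u : ι → ι → V} {L : V → V → ℝ}
    (hL0 : ∀ x : V → ℝ, (∀ p, x (u p p) = 0) → ∑ v, ∑ w, x v * L v w * x w ≤ 0 → x = 0) :
    Function.Injective (LU u L) := by
  rw [injective_iff_map_eq_zero]
  intro U hU
  have h : ∀ v q, (if (∃ p, v = u p p) then U v q else - ∑ w, L v w * U w q) = 0 := fun v q =>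
    congrFun (congrFun hU v) q
  have key : ∀ q, (fun v => U v q) = 0 := by
    intro q
    apply hL0
    · intro p
      have := h (u p p) q
      rwa [if_pos ⟨p, rfl⟩] at this
    · apply le_of_eq
      apply Finset.sum_eq_zero
      intro v _
      have hv := h v q
      simp only [mul_assoc]
      rw [← Finset.mul_sum]
      split_ifs at hv with hr
      · rw [hv]; simp
      · rw [neg_eq_zero] at hv
        rw [hv]; simp
  funext v q
  exact congrFun (key q) v

lemma F2_zero (B : ι → Finset V) (u : ι → ι → V) (L F : V → V → ℝ) (y : Sym2 ι → ℝ)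
    (U : V → ι → ℝ) : F2 B u L F y U 0 = F2 B u L F y 0 0 + LU u L U := by
  funext v q
  simp only [F2, LU, RZ, Zf, Pi.add_apply, LinearMap.coe_mk, AddHom.coe_mk]
  split_ifs <;> simp [sub_eq_add_neg]

lemma F2_lin (B : ι → Finset V) (u : ι → ι → V) (L F : V → V → ℝ) (y y' : Sym2 ι → ℝ)
    (t : ℝ) : F2 B u L F (y + t • y') 0 0 = F2 B u L F y 0 0 + t • F2 B u L F y' 0 0 := by
  funext v q
  simp only [F2, RZ, Zf, Rf, Pi.add_apply, Pi.smul_apply, smul_eq_mul]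
  split_ifs
  · simp
  · simp only [Pi.zero_apply, mul_zero, sub_zero, Finset.sum_const_zero, zero_mul, add_mul,
      Finset.sum_add_distrib, Finset.mul_sum, Finset.sum_mul]
    congr 1
    refine Finset.sum_congr rfl fun _ _ => Finset.sum_congr rfl fun _ _ =>
      Finset.sum_congr rfl fun _ _ => by ring

lemma FF_line {B : ι → Finset V} {u : ι → ι → V} (hu : ∀ p q, u p q ∈ B p)
    (hdis : ∀ p q, p ≠ q → Disjoint (B p) (B q)) (L F : V → V → ℝ) (y y' : Sym2 ι → ℝ)
    (U U' : V → ι → ℝ) (t : ℝ) :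
    FF B u L F ((y, U, 0) + t • (y', U', 0)) =
      FF B u L F (y, U, 0) + t • (y', F2 B u L F y' 0 0 + LU u L U', (0 : ℝ)) := by
  simp only [FF, Prod.smul_mk, Prod.mk_add_mk, smul_zero, add_zero, F1_zero hu hdis]
  rw [F2_zero _ _ _ _ (y + t • y'), F2_zero _ _ _ _ y, F2_lin, map_add, map_smul, smul_add]
  congr 2
  abel

lemma FF_map_nhds {B : ι → Finset V} {u : ι → ι → V} (hu : ∀ p q, u p q ∈ B p)
    (hdis : ∀ p q, p ≠ q → Disjoint (B p) (B q)) (L F : V → V → ℝ)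
    (hL0 : ∀ x : V → ℝ, (∀ p, x (u p p) = 0) → ∑ v, ∑ w, x v * L v w * x w ≤ 0 → x = 0)
    (y : Sym2 ι → ℝ) (U : V → ι → ℝ) :
    Filter.map (FF B u L F) (nhds (y, U, 0)) = nhds (FF B u L F (y, U, 0)) := by
  have hs := (FF_contDiff B u L F).contDiffAt.hasStrictFDerivAt (x := (y, U, 0)) one_ne_zero
  generalize fderiv ℝ (FF B u L F) (y, U, 0) = D at hs
  apply hs.map_nhds_eq_of_surj
  rw [LinearMap.range_eq_top]
  rw [← LinearMap.injective_iff_surjective, injective_iff_map_eq_zero]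
  rintro ⟨y', U', e⟩ hz
  have hz' : D (y', U', e) = 0 := hz
  have hline : HasDerivAt (fun t : ℝ => FF B u L F ((y, U, 0) + t • (y', U', e)))
      (D (y', U', e)) 0 := by
    have h1 : HasDerivAt (fun t : ℝ => ((y, U, 0) : (Sym2 ι → ℝ) × (V → ι → ℝ) × ℝ)
        + t • (y', U', e)) ((1 : ℝ) • (y', U', e)) 0 :=
      ((hasDerivAt_id (0 : ℝ)).smul_const (y', U', e)).const_add _
    have h2 : HasFDerivAt (FF B u L F) D (((y, U, 0) : (Sym2 ι → ℝ) × (V → ι → ℝ) × ℝ)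
        + (0 : ℝ) • (y', U', e)) := by
      rw [zero_smul, add_zero]; exact hs.hasFDerivAt
    have := h2.comp_hasDerivAt (0 : ℝ) h1
    rwa [one_smul] at this
  have he : e = 0 := by
    have h3 : HasDerivAt (fun t : ℝ => (0 : ℝ) + t * e) (D (y', U', e)).2.2 0 :=
      hline.snd.snd
    have h4 : HasDerivAt (fun t : ℝ => (0 : ℝ) + t * e) e 0 := by
      simpa using ((hasDerivAt_id (0 : ℝ)).mul_const e).const_add 0
    rw [hz'] at h3
    exact h4.unique h3
  subst he
  have hline2 : HasDerivAt (fun t : ℝ => FF B u L F ((y, U, 0) + t • (y', U', 0)))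
      ((1 : ℝ) • (y', F2 B u L F y' 0 0 + LU u L U', (0 : ℝ))) 0 := by
    simp only [FF_line hu hdis]
    exact ((hasDerivAt_id (0 : ℝ)).smul_const _).const_add _
  have h5 := hline2.unique hline
  rw [hz', one_smul, Prod.mk_eq_zero, Prod.mk_eq_zero] at h5
  obtain ⟨hy, hU, -⟩ := h5
  have hF20 : F2 B u L F 0 0 0 = 0 := by
    funext v q
    simp [F2, RZ, Rf]
  subst hy
  rw [hF20, zero_add] at hU
  have := (injective_iff_map_eq_zero _).1 (LU_inj hL0) U' hU
  subst this
  rfl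

end core

end NGP

namespace NGP

section core2

variable {V ι : Type} [Fintype V] [Fintype ι]

lemma ev_sphere {X E : Type} [TopologicalSpace X] [NormedAddCommGroup E] [NormedSpace ℝ E]
    [FiniteDimensional ℝ E] (x₀ : X) (T : Set E) (hT : IsClosed T)
    (hTs : ∀ (c : ℝ), ∀ w ∈ T, c • w ∈ T)
    (g : X → E → ℝ) (hg : Continuous (fun z : X × E => g z.1 z.2))
    (hhom : ∀ x c w, g x (c • w) = c ^ 2 * g x w)
    (hpos : ∀ w ∈ T, w ≠ 0 → 0 < g x₀ w) :
    ∀ᶠ x in nhds x₀, ∀ w ∈ T, w ≠ 0 → 0 < g x w := by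
  have hK : IsCompact (Metric.sphere (0 : E) 1 ∩ T) := (isCompact_sphere 0 1).inter_right hT
  have h1 : ∀ᶠ x in nhds x₀, ∀ w ∈ Metric.sphere (0 : E) 1 ∩ T, 0 < g x w := by
    apply hK.eventually_forall_of_forall_eventually
    intro w hw
    have hw0 : w ≠ 0 := by
      rintro rfl
      simpa using hw.1
    exact (hg.tendsto (x₀, w)).eventually (lt_mem_nhds (hpos w hw.2 hw0))
  filter_upwards [h1] with x hx w hwT hw
  have hn : ‖w‖ ≠ 0 := norm_ne_zero_iff.2 hw
  have h2 := hx (‖w‖⁻¹ • w) ⟨by simp [norm_smul, hn], hTs _ w hwT⟩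
  rw [hhom] at h2
  have : 0 < (‖w‖⁻¹) ^ 2 := by positivity
  exact (mul_pos_iff_of_pos_left this).1 h2

lemma core_exists {B : ι → Finset V} {u : ι → ι → V} (hu : ∀ p q, u p q ∈ B p)
    (hdis : ∀ p q, p ≠ q → Disjoint (B p) (B q)) (L F : V → V → ℝ)
    (hL0 : ∀ x : V → ℝ, (∀ p, x (u p p) = 0) → ∑ v, ∑ w, x v * L v w * x w ≤ 0 → x = 0)
    (s : ℝ) (hs : s ≠ 0) :
    ∃ (ε : ℝ) (y : Sym2 ι → ℝ) (U : V → ι → ℝ), 0 < ε ∧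
      F1 B u F y U ε = (fun _ => s) ∧ F2 B u L F y U ε = 0 ∧ (∀ t, 0 < y t * s) ∧
      (∀ w : V → ℝ, (∀ p, w (u p p) = 0) → w ≠ 0 →
        0 < ∑ v, ∑ v', w v * (L v v' + ε * Rf u F y ε v v') * w v') ∧
      (∀ Y : ι → ι → ℝ, Y ≠ 0 → ∃ p q,
        ∑ a, ∑ b, Zf B U ε (u p q) a * Y a b * Zf B U ε (u q p) b ≠ 0) := by
  have hsurj := LinearMap.injective_iff_surjective.1 (LU_inj (u := u) hL0)
  obtain ⟨U0, hU0⟩ := hsurj (- F2 B u L F (fun _ => s) 0 0)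
  have hF0 : FF B u L F ((fun _ => s), U0, 0) = ((fun _ => s), 0, 0) := by
    simp only [FF, F1_zero hu hdis]
    rw [F2_zero, hU0, add_neg_cancel]
  have hmap := FF_map_nhds hu hdis L F hL0 (fun _ => s) U0
  rw [hF0] at hmap
  have e1 : ∀ᶠ z : (Sym2 ι → ℝ) × (V → ι → ℝ) × ℝ in nhds ((fun _ => s), U0, 0),
      ∀ t, 0 < z.1 t * s := by
    rw [Filter.eventually_all]
    intro t
    have hc : Continuous (fun z : (Sym2 ι → ℝ) × (V → ι → ℝ) × ℝ => z.1 t * s) := by fun_prop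
    exact (hc.tendsto ((fun _ => s), U0, 0)).eventually (lt_mem_nhds (mul_self_pos.2 hs))
  have e2 : ∀ᶠ z : (Sym2 ι → ℝ) × (V → ι → ℝ) × ℝ in nhds ((fun _ => s), U0, 0),
      ∀ w ∈ {w : V → ℝ | ∀ p, w (u p p) = 0}, w ≠ 0 →
        0 < ∑ v, ∑ v', w v * (L v v' + z.2.2 * Rf u F z.1 z.2.2 v v') * w v' := by
    apply ev_sphere (g := fun (z : (Sym2 ι → ℝ) × (V → ι → ℝ) × ℝ) (w : V → ℝ) =>
      ∑ v, ∑ v', w v * (L v v' + z.2.2 * Rf u F z.1 z.2.2 v v') * w v')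
    · simp only [Set.ofPred_forall]
      exact isClosed_iInter fun p => isClosed_eq (continuous_apply _) continuous_const
    · intro c w hw p
      simp [hw p]
    · unfold Rf
      fun_prop
    · intro z c w
      simp only [Pi.smul_apply, smul_eq_mul, Finset.mul_sum]
      exact Finset.sum_congr rfl fun _ _ => Finset.sum_congr rfl fun _ _ => by ring
    · intro w hw hw0
      by_contra hcon
      apply hw0
      apply hL0 w hw
      simpa using hcon
  have e3 : ∀ᶠ z : (Sym2 ι → ℝ) × (V → ι → ℝ) × ℝ in nhds ((fun _ => s), U0, 0),
      ∀ Y ∈ (Set.univ : Set (ι → ι → ℝ)), Y ≠ 0 → 0 < ∑ p, ∑ q,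
        (∑ a, ∑ b, Zf B z.2.1 z.2.2 (u p q) a * Y a b * Zf B z.2.1 z.2.2 (u q p) b) ^ 2 := by
    refine ev_sphere _ Set.univ isClosed_univ (fun _ _ _ => trivial)
      (fun (z : (Sym2 ι → ℝ) × (V → ι → ℝ) × ℝ) (Y : ι → ι → ℝ) => ∑ p, ∑ q,
        (∑ a, ∑ b, Zf B z.2.1 z.2.2 (u p q) a * Y a b * Zf B z.2.1 z.2.2 (u q p) b) ^ 2) ?_ ?_ ?_
    · unfold Zf
      fun_prop
    · intro z c Y
      simp only [Pi.smul_apply, smul_eq_mul, Finset.mul_sum]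
      refine Finset.sum_congr rfl fun p _ => Finset.sum_congr rfl fun q _ => ?_
      rw [← mul_pow, Finset.mul_sum]
      congr 1
      refine Finset.sum_congr rfl fun a _ => ?_
      rw [Finset.mul_sum]
      exact Finset.sum_congr rfl fun b _ => by ring
    · intro Y _ hY
      have hval : ∀ p q, ∑ a, ∑ b, Zf B U0 0 (u p q) a * Y a b * Zf B U0 0 (u q p) b = Y p q := by
        intro p q
        simp only [Zf, zero_mul, sub_zero, Cf_u hu hdis]
        simp
      simp only [hval]
      obtain ⟨p, hp⟩ := Function.ne_iff.1 hY
      obtain ⟨q, hq⟩ := Function.ne_iff.1 hp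
      have hq' : Y p q ≠ 0 := hq
      refine Finset.sum_pos' (fun _ _ => Finset.sum_nonneg fun _ _ => sq_nonneg _)
        ⟨p, Finset.mem_univ _, Finset.sum_pos' (fun _ _ => sq_nonneg _)
          ⟨q, Finset.mem_univ _, by positivity⟩⟩
  have hev := (e1.and (e2.and e3))
  have himg : ∀ᶠ z in nhds (((fun _ => s), 0, 0) : (Sym2 ι → ℝ) × (V → ι → ℝ) × ℝ),
      ∃ z', FF B u L F z' = z ∧ ((∀ t, 0 < z'.1 t * s) ∧ (∀ w ∈ {w : V → ℝ | ∀ p, w (u p p) = 0}, w ≠ 0 →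
        0 < ∑ v, ∑ v', w v * (L v v' + z'.2.2 * Rf u F z'.1 z'.2.2 v v') * w v') ∧
        ∀ Y ∈ (Set.univ : Set (ι → ι → ℝ)), Y ≠ 0 → 0 < ∑ p, ∑ q,
        (∑ a, ∑ b, Zf B z'.2.1 z'.2.2 (u p q) a * Y a b * Zf B z'.2.1 z'.2.2 (u q p) b) ^ 2) := by
    rw [← hmap, Filter.eventually_map]
    filter_upwards [hev] with z hz
    exact ⟨z, rfl, hz⟩
  have hc : Continuous (fun e : ℝ => (((fun _ => s), 0, e) : (Sym2 ι → ℝ) × (V → ι → ℝ) × ℝ)) := by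
    fun_prop
  have h5 := (hc.tendsto 0).eventually himg
  have h6 := (h5.filter_mono (nhdsWithin_le_nhds (s := Set.Ioi 0))).and self_mem_nhdsWithin
  obtain ⟨ε, ⟨⟨y, U, ε'⟩, hFF, hy, hw, hY⟩, hε⟩ := h6.exists
  have hε : 0 < ε := hε
  simp only [FF, Prod.mk.injEq] at hFF
  obtain ⟨f1, f2, rfl⟩ := hFF
  refine ⟨ε', y, U, hε, f1, f2, hy, hw, ?_⟩
  intro Y hY0
  by_contra hcon
  push Not at hcon
  have := hY Y trivial hY0
  simp [hcon] at this

end core2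

end NGP

namespace NGP

section mats

open Matrix

lemma mat_facts {n m : ℕ} (A : Matrix (Fin n) (Fin n) ℝ) (hA : A.IsSymm)
    (Z : Matrix (Fin n) (Fin m) ℝ) (ρ : Fin m → Fin n) (s : ℝ)
    (hZρ : ∀ p q, Z (ρ p) q = if p = q then 1 else 0)
    (hAZ : ∀ v q, (A * Z) v q = if (∃ p, v = ρ p) then s else 0)
    (hPD : ∀ w : Fin n → ℝ, (∀ p, w (ρ p) = 0) → w ≠ 0 → 0 < w ⬝ᵥ A *ᵥ w) :
    (∀ c : Fin m → ℝ, (Z *ᵥ c) ⬝ᵥ A *ᵥ (Z *ᵥ c) = s * (∑ p, c p) ^ 2) ∧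
    (∀ x : Fin n → ℝ, s * (∑ p, x (ρ p)) ^ 2 ≤ x ⬝ᵥ A *ᵥ x) ∧
    (∀ x : Fin n → ℝ, A *ᵥ x = 0 → x = Z *ᵥ (fun p => x (ρ p))) ∧
    m - 1 ≤ NG.nullity A := by
  have hinj : Function.Injective ρ := by
    intro p q h
    have h1 := hZρ p q
    rw [h, hZρ q q] at h1
    by_contra hne
    simp [hne] at h1
  have hZc : ∀ (c : Fin m → ℝ) p, (Z *ᵥ c) (ρ p) = c p := by
    intro c p
    simp [mulVec, dotProduct, hZρ]
  have hAZc : ∀ c : Fin m → ℝ, A *ᵥ (Z *ᵥ c) =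
      fun v => if (∃ p, v = ρ p) then s * ∑ p, c p else 0 := by
    intro c
    funext v
    rw [mulVec_mulVec]
    simp only [mulVec, dotProduct, hAZ]
    split_ifs
    · rw [Finset.mul_sum]
    · simp
  have hdot : ∀ (x : Fin n → ℝ) (t : ℝ), x ⬝ᵥ (fun v => if (∃ p, v = ρ p) then t else 0) =
      t * ∑ p, x (ρ p) := by
    intro x t
    simp only [dotProduct]
    have : ∀ v, x v * (if (∃ p, v = ρ p) then t else 0) =
        ∑ p, if v = ρ p then t * x (ρ p) else 0 := by
      intro v
      split_ifs with h
      · obtain ⟨p, rfl⟩ := h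
        simp [hinj.eq_iff, mul_comm]
      · rw [mul_zero, eq_comm]
        apply Finset.sum_eq_zero
        intro p _
        rw [if_neg]
        exact fun h' => h ⟨p, h'⟩
    simp only [this]
    rw [Finset.sum_comm, Finset.mul_sum]
    simp
  have hsym : ∀ x y : Fin n → ℝ, x ⬝ᵥ A *ᵥ y = y ⬝ᵥ A *ᵥ x := by
    intro x y
    rw [dotProduct_mulVec, ← mulVec_transpose, hA.eq, dotProduct_comm]
  have hw0 : ∀ x : Fin n → ℝ, ∀ p, (x - Z *ᵥ (fun p => x (ρ p))) (ρ p) = 0 := by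
    intro x p
    simp [hZc]
  have hPD' : ∀ w : Fin n → ℝ, (∀ p, w (ρ p) = 0) → 0 ≤ w ⬝ᵥ A *ᵥ w := by
    intro w hw
    by_cases h : w = 0
    · simp [h]
    · exact (hPD w hw h).le
  have h1 : ∀ c : Fin m → ℝ, (Z *ᵥ c) ⬝ᵥ A *ᵥ (Z *ᵥ c) = s * (∑ p, c p) ^ 2 := by
    intro c
    rw [hAZc, hdot]
    simp only [hZc]
    ring
  have hwz : ∀ (w : Fin n → ℝ) c, (∀ p, w (ρ p) = 0) → w ⬝ᵥ A *ᵥ (Z *ᵥ c) = 0 := by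
    intro w c hw
    rw [hAZc, hdot]
    simp [hw]
  refine ⟨h1, ?_, ?_, ?_⟩
  · intro x
    set c : Fin m → ℝ := fun p => x (ρ p) with hc
    obtain ⟨w, hw⟩ : ∃ w, w = x - Z *ᵥ c := ⟨_, rfl⟩
    have hwr : ∀ p, w (ρ p) = 0 := fun p => hw ▸ hw0 x p
    have hx : x = Z *ᵥ c + w := by rw [hw]; abel
    have : x ⬝ᵥ A *ᵥ x = s * (∑ p, c p) ^ 2 + w ⬝ᵥ A *ᵥ w := by
      conv_lhs => rw [hx]
      rw [mulVec_add, dotProduct_add, add_dotProduct, add_dotProduct, h1, hsym (Z *ᵥ c) w,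
        hwz w c hwr]
      ring
    rw [this]
    have := hPD' w hwr
    simp only [hc]
    linarith
  · intro x hx0
    by_contra hcon
    have hne : x - Z *ᵥ (fun p => x (ρ p)) ≠ 0 := sub_ne_zero.2 hcon
    have := hPD _ (hw0 x) hne
    rw [mulVec_sub, hx0, zero_sub, dotProduct_neg, hwz _ _ (hw0 x)] at this
    simp at this
  · let φ : (Fin m → ℝ) →ₗ[ℝ] ℝ := ∑ p, LinearMap.proj p
    have hφ : ∀ c, φ c = ∑ p, c p := by
      intro c; simp [φ]
    have hdim : m - 1 ≤ Module.finrank ℝ (LinearMap.ker φ) := by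
      have h2 := LinearMap.finrank_range_add_finrank_ker φ
      have h3 : Module.finrank ℝ (LinearMap.range φ) ≤ 1 := by
        simpa using Submodule.finrank_le (LinearMap.range φ)
      simp only [Module.finrank_fintype_fun_eq_card, Fintype.card_fin] at h2
      omega
    refine hdim.trans ?_
    unfold NG.nullity
    let ψ : LinearMap.ker φ →ₗ[ℝ] LinearMap.ker (Matrix.toLin' A) :=
      LinearMap.codRestrict _ ((Matrix.toLin' Z).comp (LinearMap.ker φ).subtype) (by
        intro c
        have hc : ∑ p, (c : Fin m → ℝ) p = 0 := by
          rw [← hφ]; exact c.2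
        rw [LinearMap.mem_ker]
        simp only [LinearMap.comp_apply, Submodule.subtype_apply, Matrix.toLin'_apply]
        rw [hAZc, hc]
        funext v
        simp)
    apply LinearMap.finrank_le_finrank_of_injective (f := ψ)
    intro c d hcd
    have h4 : Z *ᵥ (c : Fin m → ℝ) = Z *ᵥ (d : Fin m → ℝ) := congrArg Subtype.val hcd
    ext p
    rw [← hZc c p, ← hZc d p, h4]

end mats

section graph

open Matrix

lemma choose_u {V : Type} {m : ℕ} {G : SimpleGraph V} {B : Fin m → Finset V}
    (h1 : ∀ p, (B p).Nonempty) (h4 : ∀ p q, p ≠ q → ∃ u ∈ B p, ∃ v ∈ B q, G.Adj u v) :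
    ∃ u : Fin m → Fin m → V, (∀ p q, u p q ∈ B p) ∧ ∀ p q, p ≠ q → G.Adj (u p q) (u q p) := by
  choose e he f hf hef using h4
  choose r hr using h1
  refine ⟨fun p q => if h : p < q then e p q h.ne else if h' : q < p then f q p h'.ne else r p,
    ?_, ?_⟩
  · intro p q
    dsimp only
    split_ifs
    · exact he _ _ _
    · exact hf _ _ _
    · exact hr p
  · intro p q hpq
    dsimp only
    rcases lt_or_gt_of_ne hpq with h | h
    · rw [dif_pos h, dif_neg h.not_gt, dif_pos h]
      exact hef _ _ _
    · rw [dif_neg h.not_gt, dif_pos h, dif_pos h]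
      exact (hef _ _ _).symm

lemma lap_quad {V : Type} [Fintype V] (g : V → V → ℝ) (ex : V → ℝ) (hg : ∀ v w, g v w = g w v)
    (x : V → ℝ) :
    ∑ v, ∑ w, x v * ((if v = w then (∑ z, g v z) + ex v else 0) - g v w) * x w =
      (∑ v, ∑ w, g v w * (x v - x w) ^ 2) / 2 + ∑ v, ex v * x v ^ 2 := by
  have e1 : ∑ v, ∑ w, x v * ((if v = w then (∑ z, g v z) + ex v else 0) - g v w) * x w =
      ∑ v, ∑ w, g v w * x v ^ 2 + ∑ v, ex v * x v ^ 2 - ∑ v, ∑ w, g v w * (x v * x w) := by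
    rw [← Finset.sum_add_distrib, ← Finset.sum_sub_distrib]
    refine Finset.sum_congr rfl fun v _ => ?_
    have : ∀ w, x v * ((if v = w then (∑ z, g v z) + ex v else 0) - g v w) * x w =
        (if v = w then x v * ((∑ z, g v z) + ex v) * x w else 0) - g v w * (x v * x w) := by
      intro w
      split_ifs <;> ring
    simp only [this, Finset.sum_sub_distrib]
    simp only [Finset.sum_ite_eq, Finset.mem_univ, if_true]
    rw [← Finset.sum_mul]
    ring
  have e2 : ∑ v, ∑ w, g v w * (x v - x w) ^ 2 = ∑ v, ∑ w, g v w * x v ^ 2 +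
      ∑ v, ∑ w, g v w * x w ^ 2 - 2 * ∑ v, ∑ w, g v w * (x v * x w) := by
    simp only [Finset.mul_sum, ← Finset.sum_add_distrib, ← Finset.sum_sub_distrib]
    exact Finset.sum_congr rfl fun v _ => Finset.sum_congr rfl fun w _ => by ring
  have e3 : ∑ v, ∑ w, g v w * x w ^ 2 = ∑ v, ∑ w, g v w * x v ^ 2 := by
    rw [Finset.sum_comm]
    exact Finset.sum_congr rfl fun v _ => Finset.sum_congr rfl fun w _ => by rw [hg]
  rw [e1, e2, e3]
  ring

lemma exists_matrix {n m : ℕ} (G : SimpleGraph (Fin n)) (hm : Model G Finset.univ m)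
    (s : ℝ) (hs : s ≠ 0) :
    ∃ (A : Matrix (Fin n) (Fin n) ℝ) (Z : Matrix (Fin n) (Fin m) ℝ) (ρ : Fin m → Fin n),
      NG.DescribesGraph A G ∧ NG.StrongArnold A ∧ m - 1 ≤ NG.nullity A ∧
      (∀ c : Fin m → ℝ, (Z *ᵥ c) ⬝ᵥ A *ᵥ (Z *ᵥ c) = s * (∑ p, c p) ^ 2) ∧
      (∀ x : Fin n → ℝ, s * (∑ p, x (ρ p)) ^ 2 ≤ x ⬝ᵥ A *ᵥ x) ∧
      (s < 0 → ∀ i j, i ≠ j → A i j ≤ 0) := by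
  obtain ⟨B, hB1, -, hdis, hB4⟩ := hm
  obtain ⟨u, hu, hadj⟩ := choose_u (fun p => (hB1 p).1) hB4
  have huniq : ∀ {v p q}, v ∈ B p → v ∈ B q → p = q := by
    intro v p q h1 h2
    by_contra h
    exact Finset.disjoint_left.1 (hdis p q h) h1 h2
  let same : Fin n → Fin n → Prop := fun v w => ∃ p, v ∈ B p ∧ w ∈ B p
  have hsame : ∀ v w, same v w → same w v := fun v w ⟨p, h1, h2⟩ => ⟨p, h2, h1⟩
  let g : Fin n → Fin n → ℝ := fun v w => if G.Adj v w ∧ same v w then 1 else 0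
  have hgs : ∀ v w, g v w = g w v := by
    intro v w
    simp only [g]
    congr 1
    rw [G.adj_comm]
    exact propext ⟨fun h => ⟨h.1, hsame _ _ h.2⟩, fun h => ⟨h.1, hsame _ _ h.2⟩⟩
  let ex : Fin n → ℝ := fun v => if ∃ p, v ∈ B p then 0 else 1
  let L : Fin n → Fin n → ℝ := fun v w => (if v = w then (∑ z, g v z) + ex v else 0) - g v w
  have hLs : ∀ v w, L v w = L w v := by
    intro v w
    simp only [L]
    rw [hgs v w]
    congr 1
    by_cases h : v = w
    · subst h; rfl
    · rw [if_neg h, if_neg (Ne.symm h)]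
  have hLC : ∀ v p, ∑ w, L v w * Cf B w p = 0 := by
    intro v p
    have : ∀ w, L v w * Cf B w p = (if v = w then ((∑ z, g v z) + ex v) * Cf B w p else 0)
        - g v w * Cf B w p := by
      intro w
      simp only [L]
      split_ifs <;> ring
    simp only [this, Finset.sum_sub_distrib, Finset.sum_ite_eq, Finset.mem_univ, if_true]
    have h1 : ∀ w, g v w * Cf B w p = g v w * Cf B v p := by
      intro w
      simp only [g]
      split_ifs with h
      · obtain ⟨-, q, h1, h2⟩ := h
        congr 1
        simp only [Cf]
        by_cases hq : q = p
        · subst hq; rw [if_pos h1, if_pos h2]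
        · rw [if_neg (fun h => hq (huniq h2 h)), if_neg (fun h => hq (huniq h1 h))]
      · simp
    simp only [h1]
    rw [← Finset.sum_mul]
    have h2 : ex v * Cf B v p = 0 := by
      simp only [ex, Cf]
      split_ifs with h3 h4 h4
      · simp
      · simp
      · exact absurd ⟨p, h4⟩ h3
      · simp
    rw [add_mul, h2]
    ring
  have hL0 : ∀ x : Fin n → ℝ, (∀ p, x (u p p) = 0) →
      ∑ v, ∑ w, x v * L v w * x w ≤ 0 → x = 0 := by
    intro x hx hle
    replace hle : (∑ v, ∑ w, g v w * (x v - x w) ^ 2) / 2 + ∑ v, ex v * x v ^ 2 ≤ 0 :=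
      le_of_eq_of_le (by rw [← lap_quad g ex hgs x]; simp only [L]; congr!) hle
    have hg0 : ∀ v w, 0 ≤ g v w * (x v - x w) ^ 2 := by
      intro v w
      have : 0 ≤ g v w := by simp only [g]; split_ifs <;> norm_num
      positivity
    have hex0 : ∀ v, 0 ≤ ex v * x v ^ 2 := by
      intro v
      have : 0 ≤ ex v := by simp only [ex]; split_ifs <;> norm_num
      positivity
    have hS1 : 0 ≤ ∑ v, ∑ w, g v w * (x v - x w) ^ 2 :=
      Finset.sum_nonneg fun v _ => Finset.sum_nonneg fun w _ => hg0 v w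
    have hS2 : 0 ≤ ∑ v, ex v * x v ^ 2 := Finset.sum_nonneg fun v _ => hex0 v
    have hz1 : ∑ v, ∑ w, g v w * (x v - x w) ^ 2 = 0 := by linarith
    have hz2 : ∑ v, ex v * x v ^ 2 = 0 := by linarith
    have hz1' : ∀ v w, g v w * (x v - x w) ^ 2 = 0 := by
      intro v w
      have h5 := (Finset.sum_eq_zero_iff_of_nonneg
        (fun v _ => Finset.sum_nonneg fun w _ => hg0 v w)).1 hz1 v (Finset.mem_univ _)
      exact (Finset.sum_eq_zero_iff_of_nonneg (fun w _ => hg0 v w)).1 h5 w (Finset.mem_univ _)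
    have hz2' : ∀ v, ex v * x v ^ 2 = 0 := fun v =>
      (Finset.sum_eq_zero_iff_of_nonneg (fun v _ => hex0 v)).1 hz2 v (Finset.mem_univ _)
    funext v
    by_cases hv : ∃ p, v ∈ B p
    · obtain ⟨p, hp⟩ := hv
      by_contra hxv
      obtain ⟨a, ha, b, hb, hbA, hab⟩ := (hB1 p).2 ((B p).filter (fun v => x v = 0))
        (Finset.filter_subset _ _) ⟨u p p, Finset.mem_filter.2 ⟨hu p p, hx p⟩⟩
        (fun h => hxv (by rw [← h] at hp; exact (Finset.mem_filter.1 hp).2))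
      rw [Finset.mem_filter] at ha
      have h6 := hz1' a b
      have h7 : g a b = 1 := by
        simp only [g]
        rw [if_pos ⟨hab, p, ha.1, hb⟩]
      rw [h7, one_mul, ha.2] at h6
      apply hbA
      rw [Finset.mem_filter]
      refine ⟨hb, ?_⟩
      have := pow_eq_zero_iff (two_ne_zero) |>.1 h6
      linarith
    · have h6 := hz2' v
      have h7 : ex v = 1 := by simp only [ex]; rw [if_neg hv]
      rw [h7, one_mul] at h6
      exact pow_eq_zero_iff (two_ne_zero) |>.1 h6
  let F : Fin n → Fin n → ℝ := fun v w =>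
    if G.Adj v w ∧ ¬ same v w ∧ ¬ ∃ p q, v = u p q ∧ w = u q p then 1 else 0
  have hFs : ∀ v w, F v w = F w v := by
    have : ∀ v w, (G.Adj v w ∧ ¬ same v w ∧ ¬ ∃ p q, v = u p q ∧ w = u q p) →
        (G.Adj w v ∧ ¬ same w v ∧ ¬ ∃ p q, w = u p q ∧ v = u q p) := by
      rintro v w ⟨h1, h2, h3⟩
      exact ⟨h1.symm, fun h => h2 (hsame _ _ h), fun ⟨p, q, h4, h5⟩ => h3 ⟨q, p, h5, h4⟩⟩
    intro v w
    simp only [F]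
    congr 1
    exact propext ⟨this v w, this w v⟩
  obtain ⟨ε, y, U, hε, hF1, hF2, hy, hPD, hSAP⟩ := core_exists hu hdis L F hL0 s hs
  have hεne : ε ≠ 0 := hε.ne'
  -- values of R
  have hR1 : ∀ p q, p ≠ q → Rf u F y ε (u p q) (u q p) = y s(p, q) := by
    intro p q hpq
    unfold Rf
    have hF : F (u p q) (u q p) = 0 := by
      simp only [F]
      rw [if_neg]
      rintro ⟨-, -, h⟩
      exact h ⟨p, q, rfl, rfl⟩
    rw [hF, mul_zero, sub_zero, Finset.sum_eq_single p, Finset.sum_eq_single q]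
    · simp
    · intro b _ hb
      rw [if_neg, mul_zero]
      rintro ⟨-, h2⟩
      exact hb (huniq (h2 ▸ hu b p) (hu q p))
    · simp
    · intro a _ ha
      apply Finset.sum_eq_zero
      intro b _
      rw [if_neg, mul_zero]
      rintro ⟨h1, -⟩
      exact ha (huniq (h1 ▸ hu a b) (hu p q))
    · simp
  have hR2 : ∀ v w, (¬ ∃ p q, v = u p q ∧ w = u q p) → Rf u F y ε v w = - ε * F v w := by
    intro v w h
    unfold Rf
    rw [Finset.sum_eq_zero]
    · ring
    · intro p _
      apply Finset.sum_eq_zero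
      intro q _
      rw [if_neg, mul_zero]
      exact fun h' => h ⟨p, q, h'⟩
  have hRs : ∀ v w, Rf u F y ε v w = Rf u F y ε w v := by
    intro v w
    unfold Rf
    rw [hFs v w, Finset.sum_comm]
    congr 1
    refine Finset.sum_congr rfl fun p _ => Finset.sum_congr rfl fun q _ => ?_
    rw [Sym2.eq_swap]
    congr 2
    exact propext and_comm
  let A : Matrix (Fin n) (Fin n) ℝ := fun v w => ε⁻¹ * L v w + Rf u F y ε v w
  have hAs : A.IsSymm := by
    refine Matrix.IsSymm.ext fun v w => ?_
    show ε⁻¹ * L w v + Rf u F y ε w v = ε⁻¹ * L v w + Rf u F y ε v w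
    rw [hLs, hRs]
  let Z : Matrix (Fin n) (Fin m) ℝ := fun v q => Zf B U ε v q
  have hUρ : ∀ p q, U (u p p) q = 0 := by
    intro p q
    have := congrFun (congrFun hF2 (u p p)) q
    simpa only [F2, if_pos (⟨p, rfl⟩ : ∃ p', u p p = u p' p'), Pi.zero_apply] using this
  have hZρ : ∀ p q, Z (u p p) q = if p = q then 1 else 0 := by
    intro p q
    simp only [Z, Zf, hUρ, Cf_u hu hdis, mul_zero, sub_zero]
    congr
  have hAZ0 : ∀ v q, (A * Z) v q = RZ B u F y U ε v q - ∑ w, L v w * U w q := by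
    intro v q
    rw [Matrix.mul_apply]
    have h1 : ∀ w, A v w * Z w q = Rf u F y ε v w * Zf B U ε w q +
        (ε⁻¹ * (L v w * Cf B w q) - L v w * U w q) := by
      intro w
      simp only [A, Z, Zf]
      field_simp
      ring
    simp only [h1, Finset.sum_add_distrib, Finset.sum_sub_distrib, ← Finset.mul_sum, hLC]
    unfold RZ
    ring
  have hAZn : ∀ v q, (¬ ∃ p, v = u p p) → (A * Z) v q = 0 := by
    intro v q h
    rw [hAZ0]
    have := congrFun (congrFun hF2 v) q
    simpa only [F2, if_neg h, Pi.zero_apply] using this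
  have hAZC : ∀ p q, ∑ v, Cf B v p * RZ B u F y U ε v q = (A * Z) (u p p) q := by
    intro p q
    have h1 : ∑ v, Cf B v p * (A * Z) v q = (A * Z) (u p p) q := by
      rw [Finset.sum_eq_single (u p p)]
      · rw [Cf_u hu hdis]; simp
      · intro v _ hv
        by_cases h : ∃ p', v = u p' p'
        · obtain ⟨p', rfl⟩ := h
          rw [Cf_u hu hdis, if_neg, zero_mul]
          rintro rfl
          exact hv rfl
        · rw [hAZn v q h, mul_zero]
      · simp
    rw [← h1]
    simp only [hAZ0, mul_sub, Finset.sum_sub_distrib]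
    have h2 : ∑ v, Cf B v p * ∑ w, L v w * U w q = 0 := by
      simp only [Finset.mul_sum]
      rw [Finset.sum_comm]
      apply Finset.sum_eq_zero
      intro w _
      have : ∀ v, Cf B v p * (L v w * U w q) = (L w v * Cf B v p) * U w q := by
        intro v; rw [hLs v w]; ring
      simp only [this]
      rw [← Finset.sum_mul, hLC, zero_mul]
    rw [h2, sub_zero]
  have hW : ∀ p q, (A * Z) (u p p) q = (Zᵀ * (A * Z)) p q := by
    intro p q
    rw [show (Zᵀ * (A * Z)) p q = ∑ v, Zᵀ p v * (A * Z) v q from Matrix.mul_apply,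
      Finset.sum_eq_single (u p p)]
    · rw [Matrix.transpose_apply, hZρ]; simp
    · intro v _ hv
      by_cases h : ∃ p', v = u p' p'
      · obtain ⟨p', rfl⟩ := h
        rw [Matrix.transpose_apply, hZρ, if_neg, zero_mul]
        rintro rfl
        exact hv rfl
      · rw [hAZn v q h, mul_zero]
    · simp
  have hWs : ∀ p q, (A * Z) (u p p) q = (A * Z) (u q q) p := by
    intro p q
    rw [hW, hW]
    have : (Zᵀ * (A * Z))ᵀ = Zᵀ * (A * Z) := by
      rw [Matrix.transpose_mul, Matrix.transpose_mul, Matrix.transpose_transpose, hAs.eq,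
        Matrix.mul_assoc]
    rw [← this, Matrix.transpose_apply, this]
  have hAZr : ∀ p q, (A * Z) (u p p) q = s := by
    intro p q
    have h1 := congrFun hF1 s(p, q)
    unfold F1 at h1
    rw [hAZC] at h1
    have h2 : s((Quot.out s(p, q)).1, (Quot.out s(p, q)).2) = s(p, q) := Quot.out_eq s(p, q)
    rcases Sym2.eq_iff.1 h2 with ⟨h3, h4⟩ | ⟨h3, h4⟩
    · rwa [h3, h4] at h1
    · rw [h3, h4] at h1
      rwa [hWs]
  have hAZ : ∀ v q, (A * Z) v q = if (∃ p, v = u p p) then s else 0 := by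
    intro v q
    split_ifs with h
    · obtain ⟨p, rfl⟩ := h
      exact hAZr p q
    · exact hAZn v q h
  have hPDA : ∀ w : Fin n → ℝ, (∀ p, w (u p p) = 0) → w ≠ 0 → 0 < w ⬝ᵥ A *ᵥ w := by
    intro w hw hw0
    have h1 := hPD w hw hw0
    have h2 : w ⬝ᵥ A *ᵥ w = ε⁻¹ *
        ∑ v, ∑ v', w v * (L v v' + ε * Rf u F y ε v v') * w v' := by
      simp only [dotProduct, mulVec, Finset.mul_sum]
      refine Finset.sum_congr rfl fun v _ => Finset.sum_congr rfl fun v' _ => ?_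
      simp only [A]
      field_simp
    rw [h2]
    positivity
  obtain ⟨f1, f2, f3, f4⟩ := mat_facts A hAs Z (fun p => u p p) s hZρ hAZ hPDA
  -- off-diagonal entries
  have hoff : ∀ v w, v ≠ w → A v w = - ε⁻¹ * g v w + Rf u F y ε v w := by
    intro v w h
    simp only [A, L, if_neg h]
    ring
  have hent : ∀ v w, v ≠ w → (A v w ≠ 0 ↔ G.Adj v w) ∧ (s < 0 → A v w ≤ 0) := by
    intro v w hvw
    rw [hoff v w hvw]
    by_cases hex : ∃ p q, v = u p q ∧ w = u q p
    · obtain ⟨p, q, rfl, rfl⟩ := hex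
      have hpq : p ≠ q := by
        rintro rfl; exact hvw rfl
      have hg : g (u p q) (u q p) = 0 := by
        simp only [g]
        rw [if_neg]
        rintro ⟨-, a, h1, h2⟩
        exact hpq ((huniq (hu p q) h1).trans (huniq h2 (hu q p)))
      rw [hg, hR1 p q hpq, mul_zero, zero_add]
      have h1 := hy s(p, q)
      refine ⟨⟨fun _ => hadj p q hpq, fun _ h => by simp [h] at h1⟩, fun hs0 => ?_⟩
      by_contra hcon
      push Not at hcon
      nlinarith
    · rw [hR2 v w hex]
      have hεi : 0 < ε⁻¹ := inv_pos.2 hε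
      by_cases hG : G.Adj v w
      · by_cases hsm : same v w
        · have hg : g v w = 1 := by simp only [g]; rw [if_pos ⟨hG, hsm⟩]
          have hF : F v w = 0 := by
            simp only [F]; rw [if_neg]; rintro ⟨-, h, -⟩; exact h hsm
          rw [hg, hF]
          refine ⟨⟨fun _ => hG, fun _ => ?_⟩, fun _ => ?_⟩
          · simp [hεne]
          · linarith
        · have hg : g v w = 0 := by simp only [g]; rw [if_neg]; rintro ⟨-, h⟩; exact hsm h
          have hF : F v w = 1 := by simp only [F]; rw [if_pos ⟨hG, hsm, hex⟩]
          rw [hg, hF]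
          refine ⟨⟨fun _ => hG, fun _ => ?_⟩, fun _ => ?_⟩
          · simp [hεne]
          · linarith
      · have hg : g v w = 0 := by simp only [g]; rw [if_neg]; rintro ⟨h, -⟩; exact hG h
        have hF : F v w = 0 := by simp only [F]; rw [if_neg]; rintro ⟨h, -⟩; exact hG h
        rw [hg, hF]
        simp [hG]
  refine ⟨A, Z, fun p => u p p, ⟨hAs, fun v w h => (hent v w h).1⟩, ?_, f4, f1, f2,
    fun h v w hvw => (hent v w hvw).2 h⟩
  -- Strong Arnold property
  intro X hX hAX hAoX hXd
  have hcol : ∀ v j, X v j = ∑ a, Z v a * X (u a a) j := by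
    intro v j
    have h1 : A *ᵥ (fun v => X v j) = 0 := by
      funext v
      have := congrFun (congrFun hAX v) j
      simpa [Matrix.mul_apply, mulVec, dotProduct] using this
    have := congrFun (f3 _ h1) v
    simpa [mulVec, dotProduct] using this
  have hXs : ∀ v w, X v w = X w v := fun v w => hX.apply w v
  have hXZ : ∀ v w, X v w = ∑ a, ∑ b, Z v a * X (u b b) (u a a) * Z w b := by
    intro v w
    rw [hcol v w]
    refine Finset.sum_congr rfl fun a _ => ?_
    rw [hXs (u a a) w, hcol w (u a a), Finset.mul_sum]
    exact Finset.sum_congr rfl fun b _ => by ring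
  have hY0 : (fun a b => X (u b b) (u a a)) = (0 : Fin m → Fin m → ℝ) := by
    by_contra hne
    obtain ⟨p, q, hpq⟩ := hSAP _ hne
    apply hpq
    refine (hXZ (u p q) (u q p)).symm.trans ?_
    by_cases h : p = q
    · subst h; exact hXd _
    · have h1 := ((hent _ _ (hadj p q h).ne).1).2 (hadj p q h)
      exact (mul_eq_zero.1 (hAoX (u p q) (u q p))).resolve_left h1
  ext v w
  rw [hXZ v w, Matrix.zero_apply]
  apply Finset.sum_eq_zero
  intro a _
  apply Finset.sum_eq_zero
  intro b _
  have : X (u b b) (u a a) = 0 := congrFun (congrFun hY0 a) b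
  rw [this]
  ring

end graph

end NGP

namespace NGP

section lower

open Matrix

lemma nullity_le {n : ℕ} (A : Matrix (Fin n) (Fin n) ℝ) : NG.nullity A ≤ n := by
  unfold NG.nullity
  refine (Submodule.finrank_le _).trans ?_
  simp

lemma neg_card {n m : ℕ} (hm : 1 ≤ m) (A : Matrix (Fin n) (Fin n) ℝ) (hA : A.IsHermitian)
    (Z : Matrix (Fin n) (Fin m) ℝ) (ρ : Fin m → Fin n)
    (h1 : ∀ c : Fin m → ℝ, (Z *ᵥ c) ⬝ᵥ A *ᵥ (Z *ᵥ c) = (-1) * (∑ p, c p) ^ 2)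
    (h2 : ∀ x : Fin n → ℝ, (-1) * (∑ p, x (ρ p)) ^ 2 ≤ x ⬝ᵥ A *ᵥ x) :
    (Finset.univ.filter (fun i => hA.eigenvalues i < 0)).card = 1 := by
  apply le_antisymm
  · rw [Finset.card_le_one]
    intro i hi j hj
    rw [Finset.mem_filter] at hi hj
    by_contra hij
    set vi : Fin n → ℝ := (hA.eigenvectorBasis i).ofLp with hvi
    set vj : Fin n → ℝ := (hA.eigenvectorBasis j).ofLp with hvj
    have e1 : A *ᵥ vi = hA.eigenvalues i • vi := hA.mulVec_eigenvectorBasis i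
    have e2 : A *ᵥ vj = hA.eigenvalues j • vj := hA.mulVec_eigenvectorBasis j
    have o := hA.eigenvectorBasis.orthonormal
    have key : ∀ k l, (hA.eigenvectorBasis k).ofLp ⬝ᵥ (hA.eigenvectorBasis l).ofLp
        = if l = k then 1 else 0 := by
      intro k l
      have := (orthonormal_iff_ite.1 o) l k
      rw [← this, EuclideanSpace.inner_eq_star_dotProduct]
      simp
    have o1 : vi ⬝ᵥ vi = 1 := by rw [hvi, key]; simp
    have o2 : vj ⬝ᵥ vj = 1 := by rw [hvj, key]; simp
    have o3 : vi ⬝ᵥ vj = 0 := by rw [hvi, hvj, key, if_neg (Ne.symm hij)]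
    have o4 : vj ⬝ᵥ vi = 0 := by rw [hvi, hvj, key, if_neg hij]
    have main : ∀ a b : ℝ, (-1) * (a * (∑ p, vi (ρ p)) + b * (∑ p, vj (ρ p))) ^ 2 ≤
        a ^ 2 * hA.eigenvalues i + b ^ 2 * hA.eigenvalues j := by
      intro a b
      have := h2 (a • vi + b • vj)
      rw [mulVec_add, mulVec_smul, mulVec_smul, e1, e2] at this
      simp only [dotProduct_add, add_dotProduct, smul_dotProduct, dotProduct_smul, o1, o2, o3, o4,
        smul_eq_mul, Pi.add_apply, Pi.smul_apply, Finset.sum_add_distrib, ← Finset.mul_sum] at this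
      linarith
    set P := ∑ p, vi (ρ p)
    set Q := ∑ p, vj (ρ p)
    by_cases hP : P = 0
    · have := main 1 0
      rw [hP] at this
      simp at this
      linarith [hi.2]
    · have := main Q (-P)
      have h3 : Q * P + -P * Q = 0 := by ring
      rw [h3] at this
      have h4 : 0 < P ^ 2 := by positivity
      nlinarith [hi.2, hj.2, sq_nonneg Q]
  · rw [Nat.one_le_iff_ne_zero, Ne, Finset.card_eq_zero]
    intro hcon
    have hps : A.PosSemidef := by
      rw [hA.posSemidef_iff_eigenvalues_nonneg]
      intro i
      by_contra h
      have : i ∈ (Finset.univ.filter (fun i => hA.eigenvalues i < 0)) := by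
        simp only [Finset.mem_filter, Finset.mem_univ, true_and]
        exact not_le.1 h
      rw [hcon] at this
      simp at this
    have h3 := hps.dotProduct_mulVec_nonneg (Z *ᵥ (Pi.single ⟨0, hm⟩ 1))
    rw [star_trivial, h1] at h3
    simp at h3
    linarith

lemma beta_lower {n m : ℕ} (G : SimpleGraph (Fin n)) (hm : Model G Finset.univ m)
    (β : (m : ℕ) → SimpleGraph (Fin m) → ℕ)
    (hβ : β = NG.nuParam ∨ β = NG.xiParam ∨ β = NG.muParam) : m ≤ β n G + 1 := by
  by_cases hm0 : m = 0
  · omega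
  have hm1 : 1 ≤ m := by omega
  suffices m - 1 ≤ β n G by omega
  rcases hβ with rfl | rfl | rfl
  · obtain ⟨A, Z, ρ, a1, a2, a3, a4, a5, a6⟩ := exists_matrix G hm 1 one_ne_zero
    refine a3.trans (le_csSup ⟨n, ?_⟩ ⟨A, a1, ?_, a2, rfl⟩)
    · rintro k ⟨A, -, -, -, rfl⟩
      exact nullity_le A
    · refine Matrix.PosSemidef.of_dotProduct_mulVec_nonneg ?_ ?_
      · rw [Matrix.IsHermitian, Matrix.conjTranspose_eq_transpose_of_trivial]; exact a1.1
      · intro x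
        rw [star_trivial]
        exact le_trans (by positivity) (a5 x)
  · obtain ⟨A, Z, ρ, a1, a2, a3, a4, a5, a6⟩ := exists_matrix G hm 1 one_ne_zero
    refine a3.trans (le_csSup ⟨n, ?_⟩ ⟨A, a1, a2, rfl⟩)
    rintro k ⟨A, -, -, rfl⟩
    exact nullity_le A
  · obtain ⟨A, Z, ρ, a1, a2, a3, a4, a5, a6⟩ := exists_matrix G hm (-1) (by norm_num)
    have hA : A.IsHermitian := by
      rw [Matrix.IsHermitian, Matrix.conjTranspose_eq_transpose_of_trivial]; exact a1.1
    refine a3.trans (le_csSup ⟨n, ?_⟩ ⟨A, hA, a1, a2, neg_card hm1 A hA Z ρ a4 a5,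
      a6 (by norm_num), rfl⟩)
    rintro k ⟨A, -, -, -, -, -, rfl⟩
    exact nullity_le A

lemma prod_lower {n r : ℕ} (hr : 2 ≤ r) (G : Fin r → SimpleGraph (Fin n)) (hG : NG.IsNDDecomp G)
    (β : (m : ℕ) → SimpleGraph (Fin m) → ℕ)
    (hβ : β = NG.nuParam ∨ β = NG.xiParam ∨ β = NG.muParam) :
    n ≤ 2 ^ (2 * r - 2) * ∏ i, β n (G i) := by
  obtain ⟨r, rfl⟩ := Nat.exists_eq_add_of_le' hr
  have h1 := comb_main r G Finset.univ (by
    intro u _ v _ huv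
    have : (⨆ i, G i).Adj u v := by rw [hG.1.2]; exact huv
    rwa [SimpleGraph.iSup_adj] at this) (fun i => β n (G i)) (by
    intro i
    have hne := hG.2 i
    have : ∃ u v, (G i).Adj u v := by
      by_contra hcon
      push Not at hcon
      apply hne
      ext u v
      simp [hcon u v]
    obtain ⟨u, v, huv⟩ := this
    have hc := model_clique (G i) Finset.univ {u, v} (Finset.subset_univ _) (by
      intro a ha b hb hab
      simp only [Finset.mem_insert, Finset.mem_singleton] at ha hb
      rcases ha with rfl | rfl <;> rcases hb with rfl | rfl
      · exact absurd rfl hab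
      · exact huv
      · exact huv.symm
      · exact absurd rfl hab)
    rw [Finset.card_pair huv.ne] at hc
    have := beta_lower (G i) hc β hβ
    show 1 ≤ β n (G i)
    omega) (fun i m hm => beta_lower (G i) hm β hβ)
  rw [Finset.card_univ, Fintype.card_fin] at h1
  have : 2 ^ (2 * (r + 2) - 2) = 4 ^ (r + 1) := by
    rw [show 2 * (r + 2) - 2 = 2 * (r + 1) by omega, pow_mul]
    norm_num
  rw [this]
  exact h1

end lower

end NGP

namespace NGP

section upper

open Matrix

lemma zig (r : ℕ) (hr : 2 ≤ r) [NeZero (2 * r)] (B : ZMod (2 * r) → ZMod (2 * r) → ℝ)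
    (y : ZMod (2 * r) → ℝ)
    (i : ZMod (2 * r))
    (hB : ∀ a b, a ≠ b → (B a b ≠ 0 ↔ (a + b = 2 * i ∨ a + b = 2 * i + 1)))
    (hk : ∀ a, ∑ b, B a b * y b = 0) (hy : y i = 0) : y = 0 := by
  have par : ∀ z : ZMod (2 * r), 2 * z ≠ 1 := by
    intro z hz
    have := congrArg (ZMod.castHom (Dvd.intro r rfl : 2 ∣ 2 * r) (ZMod 2)) hz
    rw [map_mul, map_ofNat, map_one] at this
    have h2 : (2 : ZMod 2) = 0 := rfl
    rw [h2, zero_mul] at this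
    exact absurd this (by decide)
  have force : ∀ a c, B a c ≠ 0 → (∀ b, b ≠ c → B a b * y b = 0) → y c = 0 := by
    intro a c h1 h2
    have := hk a
    rw [Finset.sum_eq_single c (fun b _ hb => h2 b hb) (by simp)] at this
    exact (mul_eq_zero.1 this).resolve_left h1
  have main : ∀ j : ℕ, y (i - j) = 0 ∧ y (i + j) = 0 := by
    intro j
    induction j with
    | zero => simp [hy]
    | succ j ih =>
      obtain ⟨h1, h2⟩ := ih
      have h3 : y (i + (j + 1)) = 0 := by
        have hne : i - (j : ZMod (2 * r)) ≠ i + (j + 1) := by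
          intro h
          apply par (-(j : ZMod (2 * r)))
          linear_combination h
        apply force (i - j) (i + (j + 1))
        · rw [hB _ _ hne]
          right; ring
        · intro b hb
          by_cases hb1 : b = i - j
          · rw [hb1, h1, mul_zero]
          by_cases hb0 : B (i - j) b = 0
          · rw [hb0, zero_mul]
          rcases (hB _ _ (Ne.symm hb1)).1 hb0 with h | h
          · have : b = i + j := by linear_combination h
            rw [this, h2, mul_zero]
          · exact absurd (by linear_combination h) hb
      push_cast
      refine ⟨?_, h3⟩
      by_cases heq : i - ((j : ZMod (2 * r)) + 1) = i + (j + 1)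
      · rw [heq, h3]
      · apply force (i + (j + 1)) (i - (j + 1))
        · rw [hB _ _ (Ne.symm heq)]
          left; ring
        · intro b hb
          by_cases hb1 : b = i + (j + 1)
          · rw [hb1, h3, mul_zero]
          by_cases hb0 : B (i + (j + 1)) b = 0
          · rw [hb0, zero_mul]
          rcases (hB _ _ (Ne.symm hb1)).1 hb0 with h | h
          · exact absurd (by linear_combination h) hb
          · have : b = i - j := by linear_combination h
            rw [this, h1, mul_zero]
  funext z
  have := (main (z - i).val).2
  rw [ZMod.natCast_zmod_val] at this
  simpa using this

lemma val_half (r : ℕ) (hr : 2 ≤ r) (i : ℕ) (hi : i < r) (a b : ℕ) :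
    ((a + b) % (2 * r)) / 2 = i ↔ ((a : ZMod (2 * r)) + b = 2 * i ∨
      (a : ZMod (2 * r)) + b = 2 * i + 1) := by
  have e1 : ((a : ZMod (2 * r)) + b = 2 * i) ↔ (a + b) % (2 * r) = 2 * i := by
    have : ((a : ZMod (2 * r)) + b = 2 * i) ↔
      (((a + b : ℕ) : ZMod (2 * r)) = ((2 * i : ℕ) : ZMod (2 * r))) := by push_cast; rfl
    rw [this, ZMod.natCast_eq_natCast_iff', Nat.mod_eq_of_lt (by omega : 2 * i < 2 * r)]
  have e2 : ((a : ZMod (2 * r)) + b = 2 * i + 1) ↔ (a + b) % (2 * r) = 2 * i + 1 := by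
    have : ((a : ZMod (2 * r)) + b = 2 * i + 1) ↔
      (((a + b : ℕ) : ZMod (2 * r)) = ((2 * i + 1 : ℕ) : ZMod (2 * r))) := by push_cast; rfl
    rw [this, ZMod.natCast_eq_natCast_iff', Nat.mod_eq_of_lt (by omega : 2 * i + 1 < 2 * r)]
  rw [e1, e2]
  omega

lemma force_all {r n : ℕ} (hr : 2 ≤ r) (hn : 2 * r ≤ n) (A : Matrix (Fin n) (Fin n) ℝ)
    (i : ℕ) (hi : i < r)
    (hA : ∀ u v : Fin n, u ≠ v → u.val < 2 * r → v.val < 2 * r →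
      (A u v ≠ 0 ↔ ((u.val + v.val) % (2 * r)) / 2 = i))
    (x : Fin n → ℝ) (hx : A *ᵥ x = 0) (hout : ∀ v : Fin n, 2 * r ≤ v.val → x v = 0)
    (hxi : x ⟨i, by omega⟩ = 0) : x = 0 := by
  haveI : NeZero (2 * r) := ⟨by omega⟩
  let e : ZMod (2 * r) → Fin n := fun a => ⟨a.val, lt_of_lt_of_le (ZMod.val_lt a) hn⟩
  have he : Function.Injective e := by
    intro a b h
    exact ZMod.val_injective _ (congrArg Fin.val h)
  have hrange : ∀ v : Fin n, v.val < 2 * r → e (v.val : ZMod (2 * r)) = v := by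
    intro v hv
    apply Fin.ext
    simp only [e]
    exact ZMod.val_cast_of_lt hv
  have hz := zig r hr (fun a b => A (e a) (e b)) (fun a => x (e a)) (i : ZMod (2 * r)) (by
      intro a b hab
      rw [hA _ _ (fun h => hab (he h)) (ZMod.val_lt a) (ZMod.val_lt b), val_half r hr i hi]
      simp only [e, ZMod.natCast_zmod_val]) (by
      intro a
      have h1 := congrFun hx (e a)
      simp only [mulVec, dotProduct, Pi.zero_apply] at h1
      rw [← h1]
      refine Fintype.sum_of_injective e he _ _ ?_ (fun b => rfl)
      intro v hv
      rw [hout v, mul_zero]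
      by_contra hlt
      exact hv ⟨_, hrange v (by omega)⟩) (by
      have : e (i : ZMod (2 * r)) = ⟨i, by omega⟩ := hrange ⟨i, by omega⟩ (by simp; omega)
      rw [this]; exact hxi)
  funext v
  by_cases hv : v.val < 2 * r
  · have := congrFun hz (v.val : ZMod (2 * r))
    simp only [hrange v hv] at this
    exact this
  · exact hout v (by omega)

lemma nullity_le_card {n : ℕ} (A : Matrix (Fin n) (Fin n) ℝ) (S : Finset (Fin n))
    (h : ∀ x : Fin n → ℝ, A *ᵥ x = 0 → (∀ v ∈ S, x v = 0) → x = 0) :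
    NG.nullity A ≤ S.card := by
  unfold NG.nullity
  let f : (Fin n → ℝ) →ₗ[ℝ] (S → ℝ) := LinearMap.funLeft ℝ ℝ (fun s : S => (s : Fin n))
  have hinj : Function.Injective (f.comp (LinearMap.ker (Matrix.toLin' A)).subtype) := by
    rw [← LinearMap.ker_eq_bot, LinearMap.ker_eq_bot']
    rintro ⟨x, hx⟩ hx0
    have hx' : A *ᵥ x = 0 := by simpa using hx
    have : x = 0 := h x hx' (fun v hv => congrFun hx0 ⟨v, hv⟩)
    exact Subtype.ext this
  have := LinearMap.finrank_le_finrank_of_injective hinj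
  simpa using this

lemma beta_le {n k : ℕ} (G : SimpleGraph (Fin n))
    (h : ∀ A, NG.DescribesGraph A G → NG.StrongArnold A → NG.nullity A ≤ k)
    (β : (m : ℕ) → SimpleGraph (Fin m) → ℕ)
    (hβ : β = NG.nuParam ∨ β = NG.xiParam ∨ β = NG.muParam) : β n G ≤ k := by
  rcases hβ with rfl | rfl | rfl
  · apply csSup_le'
    rintro m ⟨A, h1, -, h2, rfl⟩
    exact h A h1 h2
  · apply csSup_le'
    rintro m ⟨A, h1, h2, rfl⟩
    exact h A h1 h2
  · apply csSup_le'
    rintro m ⟨A, -, h1, h2, -, -, rfl⟩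
    exact h A h1 h2

/-- Colour of a pair. -/
def col (r : ℕ) (a b : ℕ) : ℕ :=
  if a < 2 * r ∧ b < 2 * r then ((a + b) % (2 * r)) / 2 else r - 1

lemma col_comm (r a b : ℕ) : col r a b = col r b a := by
  unfold col
  rw [add_comm a b]
  split_ifs <;> omega

lemma col_lt (r a b : ℕ) (hr : 2 ≤ r) : col r a b < r := by
  unfold col
  split_ifs
  · have := Nat.mod_lt (a + b) (by omega : 2 * r > 0)
    omega
  · omega

def dec (r n : ℕ) (i : Fin r) : SimpleGraph (Fin n) where
  Adj u v := u ≠ v ∧ col r u.val v.val = i.val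
  symm := ⟨fun u v h => ⟨h.1.symm, by rw [col_comm]; exact h.2⟩⟩
  loopless := ⟨fun u h => h.1 rfl⟩

lemma dec_nd {r n : ℕ} (hr : 2 ≤ r) (hn : 2 * r ≤ n) : NG.IsNDDecomp (dec r n) := by
  refine ⟨⟨?_, ?_⟩, ?_⟩
  · intro i j hij
    rw [SimpleGraph.disjoint_left]
    intro u v h1 h2
    exact hij (Fin.ext (h1.2.symm.trans h2.2))
  · ext u v
    rw [SimpleGraph.iSup_adj, SimpleGraph.top_adj]
    exact ⟨fun ⟨i, h⟩ => h.1, fun h => ⟨⟨_, col_lt r u v hr⟩, h, rfl⟩⟩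
  · intro i h
    have : (dec r n i).Adj ⟨i.val, by omega⟩ ⟨i.val + 1, by omega⟩ := by
      refine ⟨by simp, ?_⟩
      have := i.2
      simp only [col]
      rw [if_pos (by omega), Nat.mod_eq_of_lt (by omega)]
      omega
    rw [h] at this
    exact this

lemma null_last {r n : ℕ} (hr : 2 ≤ r) (hn : 2 * r ≤ n) (A : Matrix (Fin n) (Fin n) ℝ)
    (hA : NG.DescribesGraph A (dec r n ⟨r - 1, by omega⟩)) :
    NG.nullity A ≤ n - 2 * r + 1 := by
  let S : Finset (Fin n) := insert ⟨r - 1, by omega⟩ (Finset.univ.filter fun v => 2 * r ≤ v.val)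
  have hS : S.card ≤ n - 2 * r + 1 := by
    refine (Finset.card_insert_le _ _).trans ?_
    have : (Finset.univ.filter fun v : Fin n => 2 * r ≤ v.val).card ≤ (Finset.Ico (2 * r) n).card := by
      apply Finset.card_le_card_of_injOn Fin.val
      · intro v hv
        have := v.2
        simp at hv ⊢
        omega
      · exact Fin.val_injective.injOn
    rw [Nat.card_Ico] at this
    omega
  refine (nullity_le_card A S ?_).trans hS
  intro x hx h0
  refine force_all hr hn A (r - 1) (by omega) ?_ x hx ?_ (h0 _ (Finset.mem_insert_self _ _))
  · intro u v huv hu hv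
    rw [hA.2 u v huv]
    simp [dec, huv, col, hu, hv]
  · intro v hv
    exact h0 v (Finset.mem_insert_of_mem (by simp [hv]))

lemma null_other {r n : ℕ} (hr : 2 ≤ r) (hn : 2 * r ≤ n) (i : Fin r) (hi : i.val ≠ r - 1)
    (A : Matrix (Fin n) (Fin n) ℝ)
    (hA : NG.DescribesGraph A (dec r n i)) (hS : NG.StrongArnold A) :
    NG.nullity A ≤ 1 := by
  have hrow : ∀ v w : Fin n, 2 * r ≤ v.val → v ≠ w → A v w = 0 := by
    intro v w hv hvw
    by_contra h
    have := ((hA.2 v w hvw).1 h).2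
    simp only [col] at this
    rw [if_neg (by omega)] at this
    exact hi this.symm
  have hsym : ∀ v w, A v w = A w v := fun v w => hA.1.apply w v
  by_cases hex : ∃ v : Fin n, 2 * r ≤ v.val ∧ A v v = 0
  · obtain ⟨v, hv, hvv⟩ := hex
    have hr0 : ∀ w, A v w = 0 := by
      intro w
      by_cases h : v = w
      · rw [← h, hvv]
      · exact hrow v w hv h
    have hc0 : ∀ w, A w v = 0 := fun w => by rw [hsym, hr0]
    rw [← Finset.card_singleton v]
    refine nullity_le_card A {v} ?_
    intro w hw hwv
    have hwv : w v = 0 := hwv v (Finset.mem_singleton_self v)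
    let E : Fin n → ℝ := Pi.single v 1
    let X : Matrix (Fin n) (Fin n) ℝ := fun a b => E a * w b + w a * E b
    have hX := hS X (Matrix.IsSymm.ext fun a b => by simp only [X]; ring) (by
      ext a b
      rw [Matrix.mul_apply]
      have h1 : ∑ k, A a k * w k = 0 := congrFun hw a
      have h2 : ∑ k, A a k * E k = 0 := by
        simp [E, Pi.single_apply, hc0]
      have : ∀ k, A a k * X k b = (A a k * E k) * w b + (A a k * w k) * E b := by
        intro k; simp only [X]; ring
      simp only [this, Finset.sum_add_distrib, ← Finset.sum_mul, h1, h2]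
      simp) (by
      intro a b
      by_cases ha : a = v
      · rw [ha, hr0, zero_mul]
      by_cases hb : b = v
      · rw [hb, hc0, zero_mul]
      simp [X, E, ha, hb]) (by
      intro a
      by_cases ha : a = v
      · simp [X, ha, hwv]
      · simp [X, E, ha])
    funext j
    have h1 := congrFun (congrFun hX v) j
    simpa [X, E, hwv] using h1
  · push Not at hex
    rw [← Finset.card_singleton (⟨i.val, by omega⟩ : Fin n)]
    refine nullity_le_card A _ ?_
    intro x hx h0
    refine force_all hr hn A i.val i.2 ?_ x hx ?_ (h0 _ (Finset.mem_singleton_self _))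
    · intro u v huv hu hv
      rw [hA.2 u v huv]
      simp [dec, huv, col, hu, hv]
    · intro v hv
      have h1 : ∑ k, A v k * x k = 0 := congrFun hx v
      rw [Finset.sum_eq_single v (fun b _ hb => by rw [hrow v b hv (Ne.symm hb), zero_mul])
        (by simp)] at h1
      exact (mul_eq_zero.1 h1).resolve_left (hex v hv)

lemma prod_upper {r n : ℕ} (hr : 2 ≤ r) (hn : 2 * r ≤ n)
    (β : (m : ℕ) → SimpleGraph (Fin m) → ℕ)
    (hβ : β = NG.nuParam ∨ β = NG.xiParam ∨ β = NG.muParam) :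
    ∏ i, β n (dec r n i) ≤ n - 2 * r + 1 := by
  have hle : ∀ i : Fin r, β n (dec r n i) ≤
      if i = ⟨r - 1, by omega⟩ then n - 2 * r + 1 else 1 := by
    intro i
    split_ifs with h
    · subst h
      exact beta_le _ (fun A h1 _ => null_last hr hn A h1) β hβ
    · exact beta_le _ (fun A h1 h2 => null_other hr hn i (fun h' => h (Fin.ext h')) A h1 h2) β hβ
  refine (Finset.prod_le_prod' fun i _ => hle i).trans ?_
  rw [Finset.prod_ite_eq' Finset.univ]
  simp

end upper

end NGP

theorem statement19 (r n : ℕ) (hr : 2 ≤ r) (hn : 2 * r ≤ n)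
    (β : (m : ℕ) → SimpleGraph (Fin m) → ℕ)
    (hβ : β = NG.nuParam ∨ β = NG.xiParam ∨ β = NG.muParam) :
    (n : ℝ) / 2 ^ (2 * r - 2) ≤ (NG.NGprodLowND (β n) r : ℝ) ∧
    NG.NGprodLowND (β n) r ≤ n - 2 * r + 1 := by
  have hmem : (∏ i, β n (NGP.dec r n i)) ∈ {s | ∃ G : Fin r → SimpleGraph (Fin n),
      NG.IsNDDecomp G ∧ ∏ i, β n (G i) = s} := ⟨NGP.dec r n, NGP.dec_nd hr hn, rfl⟩
  constructor
  · obtain ⟨G, hG, hp⟩ := Nat.sInf_mem ⟨_, hmem⟩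
    have h1 := NGP.prod_lower hr G hG β hβ
    rw [hp] at h1
    rw [div_le_iff₀ (by positivity), mul_comm]
    exact_mod_cast h1
  · exact (Nat.sInf_le hmem).trans (NGP.prod_upper hr hn β hβ)
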